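/- Let F be a field of characteristic 2. Then the essential dimension of PGL₄ over F satisfies ed(PGL₄) ≥ 4; that is, the essential dimension of the functor assigning to each field extension K/F the set of isomorphism classes of central simple K-algebras of degree 4 is at least 4. -/

import Mathlib

set_option linter.unusedSimpArgs false
set_option linter.unusedVariables false
universe u

section PartB1
def QP (L : Type*) [Field L] (m : ℕ) : Prop :=
  ∀ (n r : ℕ) (c : Fin n → Fin n → Fin r → L), m * r < n →
    ∃ v : Fin n → L, v ≠ 0 ∧ ∀ l, ∑ i, ∑ j, c i j l * (v i * v j) = 0

lemma QP.gen {L : Type*} [Field L] {m : ℕ} (h : QP L m) {V W : Type*} [AddCommGroup V]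
    [AddCommGroup W] [Module L V] [Module L W] [Module.Finite L V] [Module.Finite L W]
    (Q : QuadraticMap L V W) (hd : m * Module.finrank L W < Module.finrank L V) :
    ∃ v ≠ 0, Q v = 0 := by
  obtain ⟨B, rfl⟩ := LinearMap.BilinMap.toQuadraticMap_surjective Q
  let bV := Module.finBasis L V
  let bW := Module.finBasis L W
  obtain ⟨v, hv, h0⟩ := h _ _ (fun i j l => bW.repr (B (bV i) (bV j)) l) hd
  refine ⟨∑ i, v i • bV i, ?_, ?_⟩
  · intro h1
    apply hv
    funext i
    exact Fintype.linearIndependent_iff.mp bV.linearIndependent v h1 i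
  · apply bW.repr.injective
    ext l
    simp only [LinearMap.BilinMap.toQuadraticMap_apply, map_sum, LinearMap.sum_apply, map_smul,
      LinearMap.smul_apply, Finsupp.coe_finsetSum, Finset.sum_apply, Finsupp.smul_apply, smul_eq_mul,
      map_zero, Finsupp.coe_zero, Pi.zero_apply]
    rw [← h0 l]
    rw [Finset.sum_comm]
    refine Finset.sum_congr rfl fun i _ => ?_
    rw [Finset.mul_sum]
    exact Finset.sum_congr rfl fun j _ => by ring

lemma QP.mono {L : Type*} [Field L] {m m' : ℕ} (h : QP L m) (hm : m ≤ m') : QP L m' :=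
  fun n r c hn => h n r c (lt_of_le_of_lt (Nat.mul_le_mul_right _ hm) hn)

open MvPolynomial in
lemma QP.base (k : Type*) [Field k] [IsAlgClosed k] : QP k 1 := by
  intro n r c hn
  by_contra! hcon
  have hdim : ringKrullDim (MvPolynomial (Fin n) k) = n := by
    rw [MvPolynomial.ringKrullDim_of_isNoetherianRing]; simp
  obtain ⟨P, hP, hPh⟩ : ∃ P : Ideal (MvPolynomial (Fin n) k), P.IsMaximal ∧
      (r : WithBot ℕ∞) < P.height := by
    by_contra! h2
    have := (ringKrullDim_le_iff_isMaximal_height_le (R := MvPolynomial (Fin n) k) r).2 h2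
    rw [hdim] at this
    have : n ≤ r := by exact_mod_cast this
    omega
  obtain ⟨a, ha⟩ := MvPolynomial.eq_vanishingIdeal_singleton_of_isMaximal k hP
  let g : Fin r → MvPolynomial (Fin n) k := fun l =>
    ∑ i, ∑ j, C (c i j l) * ((X i - C (a i)) * (X j - C (a j)))
  let I := Ideal.span (Set.range g)
  have hz : zeroLocus k I = {a} := by
    simp only [I, zeroLocus_span]
    ext v
    simp only [Set.mem_ofPred_eq, Set.mem_range, forall_exists_index, forall_apply_eq_imp_iff,
      Set.mem_singleton_iff]
    constructor
    · intro hv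
      by_contra hva
      obtain ⟨l, hl⟩ := hcon (v - a) (sub_ne_zero.2 hva)
      exact hl (by simpa [g] using hv l)
    · rintro rfl l
      simp [g]
  have hrad : I.radical = P := by
    rw [← vanishingIdeal_zeroLocus_eq_radical (K := k), hz, ha]
  have hmin : P ∈ I.minimalPrimes := by
    rw [← Ideal.radical_minimalPrimes, hrad]
    have := hP.isPrime
    simp [Ideal.minimalPrimes_eq_subsingleton_self]
  have h1 := I.height_le_spanRank_toENat_of_mem_minimalPrimes P hmin
  have h2 : I.spanRank.toENat ≤ r := by
    have : I.spanRank ≤ r := by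
      refine (Submodule.spanRank_span_le_card _).trans ?_
      classical
      have h4 : Cardinal.mk (Set.range g) ≤ (Fintype.card (Fin r) : ℕ) := by
        have : Set.range g = ((Finset.univ.image g : Finset _) : Set _) := by simp
        rw [this]
        refine (Cardinal.mk_coe_finset (s := Finset.univ.image g)).le.trans ?_
        exact_mod_cast Finset.card_image_le
      simpa using h4
    have := Cardinal.toENat.monotone' this
    simpa using this
  have h3 : P.height ≤ r := h1.trans h2
  exact absurd hPh (not_lt.2 (by exact_mod_cast h3))

lemma QP.alg {L L' : Type*} [Field L] [Field L'] [Algebra L L'] [Algebra.IsAlgebraic L L'] {m : ℕ}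
    (h : QP L m) : QP L' m := by
  intro n r c hn
  let S : Set L' := Set.range (fun x : Fin n × Fin n × Fin r => c x.1 x.2.1 x.2.2)
  let L0 := IntermediateField.adjoin L S
  have : Finite S := (Set.finite_range _)
  have hfin : FiniteDimensional L L0 :=
    IntermediateField.finiteDimensional_adjoin fun x _ => (Algebra.IsAlgebraic.isAlgebraic x).isIntegral
  let c' : Fin n → Fin n → Fin r → L0 := fun i j l =>
    ⟨c i j l, IntermediateField.subset_adjoin _ _ ⟨(i, j, l), rfl⟩⟩
  let B : (Fin n → L0) →ₗ[L0] (Fin n → L0) →ₗ[L0] (Fin r → L0) :=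
    LinearMap.mk₂ L0 (fun v w l => ∑ i, ∑ j, c' i j l * (v i * w j))
      (by intros; funext l; simp [add_mul, mul_add, Finset.sum_add_distrib])
      (by intros; funext l; simp only [Pi.smul_apply, smul_eq_mul, Finset.mul_sum]; refine Finset.sum_congr rfl fun i _ => Finset.sum_congr rfl fun j _ => by ring)
      (by intros; funext l; simp [mul_add, Finset.sum_add_distrib])
      (by intros; funext l; simp only [Pi.smul_apply, smul_eq_mul, Finset.mul_sum]; refine Finset.sum_congr rfl fun i _ => Finset.sum_congr rfl fun j _ => by ring)
  obtain ⟨v, hv, h0⟩ := h.gen ((LinearMap.BilinMap.toQuadraticMap B).restrictScalars (S := L)) (by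
    have h1 : Module.finrank L (Fin r → L0) = r * Module.finrank L L0 := by
      rw [Module.finrank_pi_fintype]; simp
    have h2 : Module.finrank L (Fin n → L0) = n * Module.finrank L L0 := by
      rw [Module.finrank_pi_fintype]; simp
    rw [h1, h2, ← mul_assoc]
    exact Nat.mul_lt_mul_of_pos_right hn Module.finrank_pos)
  refine ⟨fun i => v i, ?_, fun l => ?_⟩
  · intro h1
    apply hv
    funext i
    exact Subtype.ext (congrFun h1 i)
  · have := congrArg (fun x : L0 => (x : L')) (congrFun h0 l)
    simpa [B, c'] using this

open Polynomial in
lemma QP.frac {L L' : Type*} [Field L] [Field L'] [Algebra L[X] L'] [IsFractionRing L[X] L'] {m : ℕ}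
    (h : QP L m) : QP L' (2 * m) := by
  intro n r c hn
  obtain ⟨⟨b, hb⟩, hbc⟩ := IsLocalization.exist_integer_multiples_of_finite (nonZeroDivisors L[X])
    (fun x : Fin n × Fin n × Fin r => c x.1 x.2.1 x.2.2)
  choose p hp using hbc
  let s := Finset.univ.sup (fun x => (p x).natDegree)
  have hs : ∀ x, (p x).natDegree ≤ s := fun x => Finset.le_sup (f := fun x => (p x).natDegree) (Finset.mem_univ x)
  let N := m * r * s + 1
  let B : (Fin n → degreeLT L N) →ₗ[L] (Fin n → degreeLT L N) →ₗ[L] (Fin r → Fin (2 * N + s) → L) :=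
    LinearMap.mk₂ L (fun v w l d => (∑ i, ∑ j, p (i, j, l) * ((v i : L[X]) * (w j : L[X]))).coeff d)
      (by intros; funext l; simp [add_mul, mul_add, Finset.sum_add_distrib]; rfl)
      (by intros; funext l d; simp [Finset.mul_sum])
      (by intros; funext l; simp [mul_add, Finset.sum_add_distrib]; rfl)
      (by intros; funext l d; simp [Finset.mul_sum])
  have hN : Module.finrank L (degreeLT L N) = N := by
    rw [Module.finrank_eq_card_basis (degreeLT.basis L N)]; simp
  have : Module.Finite L (degreeLT L N) := Module.Finite.of_basis (degreeLT.basis L N)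
  obtain ⟨v, hv, h0⟩ := h.gen (LinearMap.BilinMap.toQuadraticMap B) (by
    have h1 : Module.finrank L (Fin r → Fin (2 * N + s) → L) = r * (2 * N + s) := by
      rw [Module.finrank_pi_fintype]; simp
    have h2 : Module.finrank L (Fin n → degreeLT L N) = n * N := by
      rw [Module.finrank_pi_fintype]; simp [hN]
    rw [h1, h2]
    have : (2 * m * r + 1) * N ≤ n * N := Nat.mul_le_mul_right _ hn
    have h3 : N = m * r * s + 1 := rfl
    nlinarith)
  have hinj : Function.Injective (algebraMap L[X] L') := IsFractionRing.injective _ _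
  refine ⟨fun i => algebraMap L[X] L' (v i), ?_, fun l => ?_⟩
  · intro h1
    apply hv
    funext i
    have := congrFun h1 i
    exact Subtype.ext (hinj (by simpa using this))
  · have hz : (∑ i, ∑ j, p (i, j, l) * ((v i : L[X]) * (v j : L[X]))) = 0 := by
      ext d
      by_cases hd : d < 2 * N + s
      · have := congrFun (congrFun h0 l) ⟨d, hd⟩
        simpa [B] using this
      · rw [coeff_zero]
        apply coeff_eq_zero_of_degree_lt
        refine lt_of_lt_of_le ?_ (show ((2 * N + s : ℕ) : WithBot ℕ) ≤ d by exact_mod_cast not_lt.1 hd)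
        rw [← mem_degreeLT]
        refine Submodule.sum_mem _ fun i _ => Submodule.sum_mem _ fun j _ => ?_
        rw [mem_degreeLT]
        by_cases hvi : (v i : L[X]) = 0
        · rw [hvi]; simp only [mul_zero, zero_mul, degree_zero]; exact WithBot.bot_lt_coe _
        by_cases hvj : (v j : L[X]) = 0
        · rw [hvj]; simp only [mul_zero, zero_mul, degree_zero]; exact WithBot.bot_lt_coe _
        have e1 := mem_degreeLT.1 (v i).2
        have e2 := mem_degreeLT.1 (v j).2
        have e3 := hs (i, j, l)
        rw [← natDegree_lt_iff_degree_lt hvi] at e1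
        rw [← natDegree_lt_iff_degree_lt hvj] at e2
        refine lt_of_le_of_lt degree_le_natDegree ?_
        have e4 := natDegree_mul_le (p := p (i, j, l)) (q := (v i : L[X]) * (v j : L[X]))
        have e5 := natDegree_mul_le (p := (v i : L[X])) (q := (v j : L[X]))
        exact_mod_cast (by omega)
    have hb0 : algebraMap L[X] L' b ≠ 0 := by
      rw [map_ne_zero_iff _ hinj]
      exact nonZeroDivisors.ne_zero hb
    apply mul_left_cancel₀ hb0
    rw [mul_zero, ← map_zero (algebraMap L[X] L'), ← hz, map_sum, Finset.mul_sum]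
    refine Finset.sum_congr rfl fun i _ => ?_
    rw [map_sum, Finset.mul_sum]
    refine Finset.sum_congr rfl fun j _ => ?_
    have := hp (i, j, l)
    simp only [Algebra.smul_def] at this
    rw [map_mul, this, map_mul]
    ring
end PartB1

section PartB2
open IntermediateField Polynomial in
lemma QP.simple {L L' : Type*} [Field L] [Field L'] [Algebra L L'] {m : ℕ} (a : L')
    (h : QP L m) : QP L⟮a⟯ (2 * m) := by
  by_cases ha : IsAlgebraic L a
  · have := isAlgebraic_adjoin_simple ha.isIntegral
    exact QP.mono h.alg (by omega)
  · have ht : Transcendental L (AdjoinSimple.gen L a) := by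
      intro h2
      apply ha
      have := h2.algebraMap (A := L')
      simpa using this
    let : Algebra (Polynomial L) L⟮a⟯ := (aeval (AdjoinSimple.gen L a)).toAlgebra
    have hm : ∀ p : L[X], algebraMap L[X] L⟮a⟯ p = aeval (AdjoinSimple.gen L a) p := fun p => rfl
    have : FaithfulSMul L[X] L⟮a⟯ := (faithfulSMul_iff_algebraMap_injective _ _).2
      (transcendental_iff_injective.1 ht)
    have : IsFractionRing (Polynomial L) L⟮a⟯ := by
      apply IsFractionRing.of_field
      rintro ⟨z, hz⟩
      obtain ⟨r, s, hrs⟩ := (mem_adjoin_simple_iff L z).1 hz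
      refine ⟨r, s, Subtype.ext ?_⟩
      rw [hm, hm]
      refine hrs.trans ?_
      rw [IntermediateField.coe_div]
      congr 1
      · exact (aeval_algebraMap_apply L' (AdjoinSimple.gen L a) r)
      · exact (aeval_algebraMap_apply L' (AdjoinSimple.gen L a) s)
    exact h.frac

lemma QP.congr {k L : Type*} [Field k] [Field L] [Algebra k L] {m : ℕ} {E E' : IntermediateField k L} (h : E = E') (hE : QP E m) : QP E' m := by
  subst h; exact hE

open IntermediateField in
lemma QP.adjoin {k L : Type*} [Field k] [Field L] [Algebra k L] {m : ℕ} (h : QP k m) (s : Finset L) :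
    QP (IntermediateField.adjoin k (s : Set L)) (2 ^ s.card * m) := by
  classical
  induction s using Finset.induction_on with
  | empty => 
    have : Algebra.IsAlgebraic k (IntermediateField.adjoin k ((∅ : Finset L) : Set L)) := by
      rw [Finset.coe_empty, adjoin_empty]
      infer_instance
    exact QP.mono h.alg (by simp)
  | insert a s has ih =>
    have h1 := QP.simple a ih
    rw [Finset.card_insert_of_notMem has, pow_succ, mul_comm (2 ^ _), mul_assoc]
    have e := adjoin_adjoin_left k (s : Set L) {a}
    refine QP.congr (E := ((IntermediateField.adjoin (IntermediateField.adjoin k (s : Set L)) {a}).restrictScalars k)) ?_ h1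
    rw [e, Finset.coe_insert, Set.insert_eq, Set.union_comm]
end PartB2

section PartB3
open Module in
lemma QP.iso {L V : Type*} [Field L] [AddCommGroup V] [Module L V] [Module.Finite L V] {m : ℕ}
    (h : QP L m) (Q : QuadraticForm L V) (n : ℕ) (hn : m + 2 * n ≤ finrank L V + 1) :
    ∃ W : Submodule L V, finrank L W = n ∧ ∀ w ∈ W, Q w = 0 := by
  induction n with
  | zero => exact ⟨⊥, by simp, by simp⟩
  | succ n ih =>
    obtain ⟨W, hW, hQ⟩ := ih (by omega)
    obtain ⟨D, hD⟩ := W.exists_isCompl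
    let f : D →ₗ[L] Dual L W :=
      (W.subtype.dualMap ∘ₗ (QuadraticMap.polarBilin Q : V →ₗ[L] V →ₗ[L] L)) ∘ₗ D.subtype
    have h1 := f.finrank_range_add_finrank_ker
    have h2 : finrank L (LinearMap.range f) ≤ n := by
      have := Submodule.finrank_le (LinearMap.range f)
      rwa [Subspace.dual_finrank_eq, hW] at this
    have h3 := Submodule.finrank_add_eq_of_isCompl hD
    obtain ⟨v, hv, hv0⟩ := h.gen (Q.comp (D.subtype ∘ₗ (LinearMap.ker f).subtype)) (by
      rw [finrank_self]; omega)
    have hvW : ((v : D) : V) ∉ W := by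
      intro hmem
      apply hv
      have := hD.disjoint.le_bot (Submodule.mem_inf.2 ⟨hmem, (v : D).2⟩)
      exact Subtype.ext (Subtype.ext (by simpa using this))
    refine ⟨W ⊔ Submodule.span L {((v : D) : V)}, ?_, ?_⟩
    · rw [Submodule.finrank_sup_span_singleton hvW, hW]
    · intro w hw
      obtain ⟨x, hx, y, hy, rfl⟩ := Submodule.mem_sup.1 hw
      obtain ⟨c, rfl⟩ := Submodule.mem_span_singleton.1 hy
      have hp : QuadraticMap.polar Q ((v : D) : V) x = 0 := by
        have := LinearMap.congr_fun (LinearMap.mem_ker.1 v.2) ⟨x, hx⟩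
        exact this
      have hv0' : Q ((v : D) : V) = 0 := hv0
      rw [QuadraticMap.map_add Q, QuadraticMap.map_smul, hQ x hx, hv0', QuadraticMap.polar_smul_right,
        QuadraticMap.polar_comm, hp]
      simp
end PartB3

section PartC1
/-- coefficient form of a quadratic form. -/
def qev {R ι : Type*} [Fintype ι] [CommRing R] (c : ι → ι → R) (v : ι → R) : R :=
  ∑ i, ∑ j, c i j * (v i * v j)

def QAn {R ι : Type*} [Fintype ι] [CommRing R] (c : ι → ι → R) : Prop :=
  ∀ v, qev c v = 0 → v = 0

def qblk {R ι κ : Type*} [CommRing R] (c : ι → ι → R) (d : κ → κ → R) : ι ⊕ κ → ι ⊕ κ → R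
  | Sum.inl i, Sum.inl j => c i j
  | Sum.inr i, Sum.inr j => d i j
  | _, _ => 0

lemma qev_blk {R ι κ : Type*} [Fintype ι] [Fintype κ] [CommRing R] (c : ι → ι → R) (d : κ → κ → R)
    (v : ι ⊕ κ → R) : qev (qblk c d) v = qev c (fun i => v (Sum.inl i)) + qev d (fun i => v (Sum.inr i)) := by
  simp [qev, qblk, Fintype.sum_sum_type]

lemma qev_smul {R ι : Type*} [Fintype ι] [CommRing R] (c : ι → ι → R) (a : R) (v : ι → R) :
    qev (fun i j => a * c i j) v = a * qev c v := by
  simp [qev, Finset.mul_sum, mul_assoc]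

lemma qev_vsmul {R ι : Type*} [Fintype ι] [CommRing R] (c : ι → ι → R) (a : R) (v : ι → R) :
    qev c (fun i => a * v i) = a ^ 2 * qev c v := by
  simp only [qev, Finset.mul_sum]
  exact Finset.sum_congr rfl fun i _ => Finset.sum_congr rfl fun j _ => by ring

lemma qev_map {R S ι : Type*} [Fintype ι] [CommRing R] [CommRing S] (f : R →+* S) (c : ι → ι → R)
    (v : ι → R) : f (qev c v) = qev (fun i j => f (c i j)) (fun i => f (v i)) := by
  simp [qev]

lemma QAn.smul {R ι : Type*} [Fintype ι] [Field R] {c : ι → ι → R} (h : QAn c) {a : R} (ha : a ≠ 0) :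
    QAn (fun i j => a * c i j) := by
  intro v hv
  rw [qev_smul] at hv
  exact h v ((mul_eq_zero.1 hv).resolve_left ha)

open Polynomial in
lemma QAn.key {L ι : Type*} [Fintype ι] [Field L] {c : ι → ι → L} (hc : QAn c) (v : ι → L[X])
    (hX : X ∣ qev (fun i j => C (c i j)) v) : ∃ v' : ι → L[X], v = fun i => X * v' i := by
  rw [X_dvd_iff, coeff_zero_eq_eval_zero] at hX
  have h1 := qev_map (evalRingHom (0 : L)) (fun i j => C (c i j)) v
  simp only [coe_evalRingHom, eval_C, hX] at h1
  have h2 := hc _ h1.symm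
  have h3 : ∀ i, X ∣ v i := fun i => by
    rw [X_dvd_iff, coeff_zero_eq_eval_zero]
    exact congrFun h2 i
  choose v' hv' using h3
  exact ⟨v', funext hv'⟩

open Polynomial in
lemma QAn.descent {L ι κ : Type*} [Fintype ι] [Fintype κ] [Field L] {c : ι → ι → L} {d : κ → κ → L}
    (hc : QAn c) (hd : QAn d) (n : ℕ) (v : ι → L[X]) (w : κ → L[X])
    (h : qev (fun i j => C (c i j)) v + X * qev (fun i j => C (d i j)) w = 0) :
    (∀ i, X ^ n ∣ v i) ∧ (∀ i, X ^ n ∣ w i) := by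
  induction n generalizing v w with
  | zero => simp
  | succ n ih =>
    obtain ⟨v', rfl⟩ := hc.key v ((dvd_add_left (dvd_mul_right X _)).1 (by rw [h]; exact dvd_zero _))
    rw [qev_vsmul] at h
    have h2 : X * (qev (fun i j => C (d i j)) w + X * qev (fun i j => C (c i j)) v') = 0 := by
      rw [← h]; ring
    have h3 := (mul_eq_zero.1 h2).resolve_left X_ne_zero
    obtain ⟨w', rfl⟩ := hd.key w ((dvd_add_left (dvd_mul_right X _)).1 (by rw [h3]; exact dvd_zero _))
    rw [qev_vsmul] at h3
    have h4 : X * (qev (fun i j => C (c i j)) v' + X * qev (fun i j => C (d i j)) w') = 0 := by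
      rw [← h3]; ring
    obtain ⟨h5, h6⟩ := ih _ _ ((mul_eq_zero.1 h4).resolve_left X_ne_zero)
    simp only [pow_succ']
    exact ⟨fun i => mul_dvd_mul_left _ (h5 i), fun i => mul_dvd_mul_left _ (h6 i)⟩

open Polynomial in
lemma QAn.ext {L ι κ : Type*} [Fintype ι] [Fintype κ] [Field L] {c : ι → ι → L} {d : κ → κ → L}
    (hc : QAn c) (hd : QAn d) :
    QAn (qblk (fun i j => RatFunc.C (c i j)) (fun i j => RatFunc.X * RatFunc.C (d i j))) := by
  intro v hv
  obtain ⟨⟨b, hb⟩, hbc⟩ := IsLocalization.exist_integer_multiples_of_finite (nonZeroDivisors L[X]) v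
  choose p hp using hbc
  have hinj : Function.Injective (algebraMap L[X] (RatFunc L)) := IsFractionRing.injective _ _
  have hb0 : algebraMap L[X] (RatFunc L) b ≠ 0 := by
    rw [map_ne_zero_iff _ hinj]
    exact nonZeroDivisors.ne_zero hb
  have hp' : (fun i => algebraMap L[X] (RatFunc L) (p i)) = fun i => algebraMap L[X] (RatFunc L) b * v i := by
    funext i
    rw [hp i, Algebra.smul_def]
  have h1 : qev (fun i j => C (c i j)) (fun i => p (Sum.inl i)) +
      X * qev (fun i j => C (d i j)) (fun i => p (Sum.inr i)) = 0 := by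
    apply hinj
    rw [map_zero, map_add, map_mul, qev_map, qev_map]
    have := qev_vsmul (qblk (fun i j => RatFunc.C (c i j)) (fun i j => RatFunc.X * RatFunc.C (d i j)))
      (algebraMap L[X] (RatFunc L) b) v
    rw [hv, mul_zero, ← hp', qev_blk, qev_smul] at this
    rw [← this]
    simp
  have h2 : ∀ i, p i = 0 := by
    intro i
    have h3 : ∀ n, X ^ n ∣ p i := by
      intro n
      obtain ⟨h3, h4⟩ := QAn.descent hc hd n _ _ h1
      cases i with
      | inl i => exact h3 i
      | inr i => exact h4 i
    by_contra h0
    have := natDegree_le_of_dvd (h3 ((p i).natDegree + 1)) h0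
    simp at this
  funext i
  have := congrFun hp' i
  rw [h2 i, map_zero] at this
  exact (mul_eq_zero.1 this.symm).resolve_left hb0

lemma QAn.inl {L ι κ : Type*} [Fintype ι] [Fintype κ] [Field L] {c : ι → ι → L} {d : κ → κ → L}
    (h : QAn (qblk c d)) : QAn c := by
  intro v hv
  have := h (Sum.elim v 0) (by rw [qev_blk]; simp [hv]; simp [qev])
  funext i
  exact congrFun this (Sum.inl i)

lemma QAn.C {L ι : Type*} [Fintype ι] [Field L] {c : ι → ι → L} (hc : QAn c) :
    QAn (fun i j => RatFunc.C (c i j)) := (hc.ext hc).inl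

open Polynomial in
lemma an_base {k : Type*} [Field k] [CharP k 2] {x y : RatFunc k}
    (h : x ^ 2 + x * y + RatFunc.X ^ 2 * y ^ 2 = 0) : x = 0 ∧ y = 0 := by
  by_cases hy : y = 0
  · subst hy; simpa using h
  exfalso
  have : CharP (RatFunc k) 2 := charP_of_injective_algebraMap (algebraMap k (RatFunc k)).injective 2
  have h2 : (2 : RatFunc k) = 0 := CharP.cast_eq_zero (RatFunc k) 2
  obtain ⟨S, hS⟩ : ∃ S : RatFunc k, S ^ 2 + S = RatFunc.X := by
    refine ⟨x / y + RatFunc.X, ?_⟩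
    field_simp
    linear_combination h + (x * RatFunc.X * y) * h2
  have hint : IsIntegral k[X] S := by
    refine ⟨X ^ 2 + X - C X, by monicity!, ?_⟩
    simp [hS]
  obtain ⟨p, rfl⟩ := IsIntegrallyClosed.isIntegral_iff.1 hint
  rw [← RatFunc.algebraMap_X, ← map_pow, ← map_add] at hS
  have hp := IsFractionRing.injective k[X] (RatFunc k) hS
  have h3 : p * (p + 1) = X := by rw [← hp]; ring
  have h4 := congrArg natDegree h3
  have hp0 : p ≠ 0 := by rintro rfl; rw [zero_mul] at h3; exact X_ne_zero h3.symm
  have hp1 : p + 1 ≠ 0 := by intro h; rw [h, mul_zero] at h3; exact X_ne_zero h3.symm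
  rw [natDegree_mul hp0 hp1, natDegree_X, show (1 : k[X]) = C 1 by simp, natDegree_add_C] at h4
  omega
end PartC1

section PartC2
def nf {K : Type*} [CommRing K] (w x y : K) : K := x ^ 2 + x * y + w ^ 2 * y ^ 2

structure HAn {K : Type*} [Field K] (t w c d : K) : Prop where
  an : ∀ x1 x2 x3 x4 y1 y2 y3 y4 z1 z2 z3 z4 : K,
    c * (nf w x1 x2 + t * nf w x3 x4) + d * (nf w y1 y2 + t * nf w y3 y4) +
      c * d * w * (nf w z1 z2 + t * nf w z3 z4) = 0 →
    (x1 = 0 ∧ x2 = 0 ∧ x3 = 0 ∧ x4 = 0) ∧ (y1 = 0 ∧ y2 = 0 ∧ y3 = 0 ∧ y4 = 0) ∧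
      (z1 = 0 ∧ z2 = 0 ∧ z3 = 0 ∧ z4 = 0)

def ncoef {K : Type*} [CommRing K] (w : K) : Fin 2 → Fin 2 → K := ![![1, 1], ![0, w ^ 2]]

lemma qev_ncoef {K : Type*} [CommRing K] (w : K) (v : Fin 2 → K) : qev (ncoef w) v = nf w (v 0) (v 1) := by
  simp [qev, ncoef, nf, Fin.sum_univ_two]; ring

lemma C_ncoef {K : Type*} [Field K] (w : K) :
    (fun i j => RatFunc.C (ncoef w i j)) = ncoef (RatFunc.C w) := by
  funext i j; fin_cases i <;> fin_cases j <;> simp [ncoef]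

lemma C_qblk {K ι κ : Type*} [Field K] (c : ι → ι → K) (d : κ → κ → K) :
    (fun i j => RatFunc.C (qblk c d i j)) =
      qblk (fun i j => RatFunc.C (c i j)) (fun i j => RatFunc.C (d i j)) := by
  funext i j; rcases i with i | i <;> rcases j with j | j <;> simp [qblk]

lemma C_smul {K ι : Type*} [Field K] (a : K) (c : ι → ι → K) :
    (fun i j => RatFunc.C (a * c i j)) = fun i j => RatFunc.C a * RatFunc.C (c i j) := by
  funext i j; simp

def fcoef {K : Type*} [CommRing K] (t w : K) : Fin 2 ⊕ Fin 2 → Fin 2 ⊕ Fin 2 → K :=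
  qblk (ncoef w) (fun i j => t * ncoef w i j)

lemma qev_fcoef {K : Type*} [CommRing K] (t w : K) (v) : qev (fcoef t w) v =
    nf w (v (Sum.inl 0)) (v (Sum.inl 1)) + t * nf w (v (Sum.inr 0)) (v (Sum.inr 1)) := by
  rw [fcoef, qev_blk, qev_smul, qev_ncoef, qev_ncoef]

lemma C_fcoef {K : Type*} [Field K] (t w : K) :
    (fun i j => RatFunc.C (fcoef t w i j)) = fcoef (RatFunc.C t) (RatFunc.C w) := by
  have h2 := C_ncoef w
  simp only [funext_iff] at h2
  rw [fcoef, C_qblk, C_smul, C_ncoef]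
  simp only [h2]; rfl

lemma an_s1 {k : Type*} [Field k] [CharP k 2] : QAn (ncoef (RatFunc.X : RatFunc k)) := by
  intro v hv
  rw [qev_ncoef] at hv
  obtain ⟨h1, h2⟩ := an_base hv
  funext i; fin_cases i
  · exact h1
  · exact h2

lemma an_s2 {L : Type*} [Field L] {w : L} (h : QAn (ncoef w)) :
    QAn (fcoef (RatFunc.X) (RatFunc.C w)) := by
  have := h.ext h
  have h2 := C_ncoef w
  simp only [funext_iff] at h2
  simp only [h2] at this
  exact this

lemma an_s3 {L : Type*} [Field L] {t w : L} (hw : w ≠ 0) (h : QAn (fcoef t w)) :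
    QAn (fcoef (RatFunc.C t) (RatFunc.C w)) ∧ QAn (qblk (fcoef (RatFunc.C t) (RatFunc.C w))
      (fun i j => (RatFunc.X * RatFunc.C w) * fcoef (RatFunc.C t) (RatFunc.C w) i j)) := by
  have h1 := h.C
  have h3 := h.ext (h.smul hw)
  rw [C_fcoef] at h1
  refine ⟨h1, ?_⟩
  have h2 := C_fcoef t w
  simp only [funext_iff] at h2
  simpa only [h2, map_mul, mul_assoc] using h3

lemma an_s4 {L : Type*} [Field L] {t w c : L} (hc : c ≠ 0) (h1 : QAn (fcoef t w))
    (h2 : QAn (qblk (fcoef t w) (fun i j => (c * w) * fcoef t w i j))) :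
    HAn (RatFunc.C t) (RatFunc.C w) (RatFunc.C c) RatFunc.X := by
  have h3 := (h1.smul hc).ext h2
  have e := C_fcoef t w
  simp only [funext_iff] at e
  have e2 := C_qblk (fcoef t w) (fun i j => (c * w) * fcoef t w i j)
  simp only [funext_iff] at e2
  simp only [e2, map_mul, e] at h3
  constructor
  intro x1 x2 x3 x4 y1 y2 y3 y4 z1 z2 z3 z4 h
  have := h3 (Sum.elim (Sum.elim ![x1, x2] ![x3, x4])
    (Sum.elim (Sum.elim ![y1, y2] ![y3, y4]) (Sum.elim ![z1, z2] ![z3, z4]))) (by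
      simp only [qev_blk, qev_smul, qev_fcoef, Sum.elim_inl, Sum.elim_inr]
      rw [← h]
      simp
      ring)
  simpa [funext_iff, Fin.forall_fin_two, and_assoc] using this

lemma hAn_e1 (k : Type u) [Field k] [CharP k 2] :
    ∃ (K : Type u) (_ : Field K) (_ : k →+* K) (w : K), w ≠ 0 ∧ QAn (ncoef w) :=
  ⟨RatFunc k, inferInstance, RatFunc.C, _, RatFunc.X_ne_zero, an_s1⟩

lemma hAn_e2 (k : Type u) [Field k] [CharP k 2] :
    ∃ (K : Type u) (_ : Field K) (_ : k →+* K) (t w : K), w ≠ 0 ∧ QAn (fcoef t w) := by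
  obtain ⟨K, _, f, w, hw, h⟩ := hAn_e1 k
  exact ⟨RatFunc K, inferInstance, RatFunc.C.comp f, _, _, by simpa using hw, an_s2 h⟩

lemma hAn_e3 (k : Type u) [Field k] [CharP k 2] :
    ∃ (K : Type u) (_ : Field K) (_ : k →+* K) (t w c : K), c ≠ 0 ∧ QAn (fcoef t w) ∧
      QAn (qblk (fcoef t w) (fun i j => (c * w) * fcoef t w i j)) := by
  obtain ⟨K, _, f, t, w, hw, h⟩ := hAn_e2 k
  exact ⟨RatFunc K, inferInstance, RatFunc.C.comp f, _, _, _, RatFunc.X_ne_zero, an_s3 hw h⟩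

lemma hAn_exists (k : Type u) [Field k] [CharP k 2] :
    ∃ (K : Type u) (_ : Field K) (_ : k →+* K) (t w c d : K), HAn t w c d := by
  obtain ⟨K, _, f, t, w, c, hc, h1, h2⟩ := hAn_e3 k
  exact ⟨RatFunc K, inferInstance, RatFunc.C.comp f, _, _, _, _, an_s4 hc h1 h2⟩
end PartC2

section PartD1
structure Biq (K M : Type*) [Field K] [CommRing M] [Algebra K M] (a b : K) where
  x : M
  y : M
  σ : M →ₐ[K] M
  τ : M →ₐ[K] M
  hx : x ^ 2 = x + algebraMap K M a
  hy : y ^ 2 = y + algebraMap K M b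
  σx : σ x = x + 1
  σy : σ y = y
  τx : τ x = x
  τy : τ y = y + 1
  span : ∀ m, ∃ p q r s : K, m = algebraMap K M p + algebraMap K M q * x + algebraMap K M r * y +
    algebraMap K M s * (x * y)
  ind : ∀ p q r s : K, algebraMap K M p + algebraMap K M q * x + algebraMap K M r * y +
    algebraMap K M s * (x * y) = 0 → p = 0 ∧ q = 0 ∧ r = 0 ∧ s = 0

abbrev BM1 (K : Type u) [Field K] (a : K) := QuadraticAlgebra K a 1
abbrev BM (K : Type u) [Field K] (a b : K) := QuadraticAlgebra (BM1 K a) ⟨b, 0⟩ 1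

lemma BM.ext' {K : Type u} [Field K] {a b : K} {m n : BM K a b} (h1 : m.re.re = n.re.re)
    (h2 : m.re.im = n.re.im) (h3 : m.im.re = n.im.re) (h4 : m.im.im = n.im.im) : m = n :=
  QuadraticAlgebra.ext (QuadraticAlgebra.ext h1 h2) (QuadraticAlgebra.ext h3 h4)

lemma BM.one_eq {K : Type u} [Field K] {a b : K} : (1 : BM K a b) = ⟨⟨1, 0⟩, ⟨0, 0⟩⟩ := rfl

def BM.σ (K : Type u) [Field K] [CharP K 2] (a b : K) : BM K a b →ₐ[K] BM K a b :=
  AlgHom.ofLinearMap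
    { toFun := fun m => ⟨⟨m.re.re + m.re.im, m.re.im⟩, ⟨m.im.re + m.im.im, m.im.im⟩⟩
      map_add' := fun m n => by apply BM.ext' <;> simp <;> ring
      map_smul' := fun m n => by apply BM.ext' <;> simp <;> ring }
    (by rw [BM.one_eq]; apply BM.ext' <;> simp)
    (fun m n => by
      have h2 : (2 : K) = 0 := CharP.cast_eq_zero K 2
      apply BM.ext' <;> simp <;> grind)

def BM.τ (K : Type u) [Field K] [CharP K 2] (a b : K) : BM K a b →ₐ[K] BM K a b :=
  AlgHom.ofLinearMap
    { toFun := fun m => ⟨⟨m.re.re + m.im.re, m.re.im + m.im.im⟩, ⟨m.im.re, m.im.im⟩⟩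
      map_add' := fun m n => by apply BM.ext' <;> simp <;> ring
      map_smul' := fun m n => by apply BM.ext' <;> simp <;> ring }
    (by rw [BM.one_eq]; apply BM.ext' <;> simp)
    (fun m n => by
      have h2 : (2 : K) = 0 := CharP.cast_eq_zero K 2
      apply BM.ext' <;> simp <;> grind)

lemma Biq.exists (K : Type u) [Field K] [CharP K 2] (a b : K) :
    ∃ (M : Type u) (_ : CommRing M) (_ : Algebra K M), Nonempty (Biq K M a b) := by
  have h2 : (2 : K) = 0 := CharP.cast_eq_zero K 2
  have amap : ∀ p : K, algebraMap K (BM K a b) p = ⟨⟨p, 0⟩, ⟨0, 0⟩⟩ := fun p => rfl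
  refine ⟨BM K a b, inferInstance, inferInstance, ⟨⟨⟨⟨0, 1⟩, ⟨0, 0⟩⟩, ⟨⟨0, 0⟩, ⟨1, 0⟩⟩, BM.σ K a b, BM.τ K a b,
    ?_, ?_, ?_, ?_, ?_, ?_, ?_, ?_⟩⟩⟩
  · rw [amap]; apply BM.ext' <;> simp [pow_two]
  · rw [amap]; apply BM.ext' <;> simp [pow_two]
  · apply BM.ext' <;> simp [BM.σ, BM.one_eq]
  · apply BM.ext' <;> simp [BM.σ, BM.one_eq]
  · apply BM.ext' <;> simp [BM.τ, BM.one_eq]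
  · apply BM.ext' <;> simp [BM.τ, BM.one_eq]
  · intro m
    refine ⟨m.re.re, m.re.im, m.im.re, m.im.im, ?_⟩
    simp only [amap]
    apply BM.ext' <;> simp
  · intro p q r s h
    simp only [amap] at h
    have e1 := congrArg (fun m : BM K a b => m.re.re) h
    have e2 := congrArg (fun m : BM K a b => m.re.im) h
    have e3 := congrArg (fun m : BM K a b => m.im.re) h
    have e4 := congrArg (fun m : BM K a b => m.im.im) h
    simp at e1 e2 e3 e4
    exact ⟨e1, e2, e3, e4⟩
end PartD1

section PartE1
structure CP (K M : Type*) [Field K] [CommRing M] [Algebra K M] where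
  σ : M →ₐ[K] M
  τ : M →ₐ[K] M
  α : M
  β : M
  κ : M
  σσ : ∀ m, σ (σ m) = m
  ττ : ∀ m, τ (τ m) = m
  τσ : ∀ m, τ (σ m) = σ (τ m)
  σα : σ α = α
  τβ : τ β = β
  rα : τ α * κ * σ κ = α
  rβ : σ β = β * κ * τ κ

namespace CP
variable {K M : Type*} [Field K] [CommRing M] [Algebra K M] (D : CP K M)

def Pu : Matrix (Fin 4) (Fin 4) M := 
  !![0, D.α, 0, 0; 1, 0, 0, 0; 0, 0, 0, D.τ D.α * D.κ; 0, 0, D.κ, 0]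

def Pv : Matrix (Fin 4) (Fin 4) M := 
  !![0, 0, D.β, 0; 0, 0, 0, D.β; 1, 0, 0, 0; 0, 1, 0, 0]

def alg : Subalgebra K (Matrix (Fin 4) (Fin 4) M) where
  carrier := {X | X * D.Pu = D.Pu * D.σ.mapMatrix X ∧ X * D.Pv = D.Pv * D.τ.mapMatrix X}
  mul_mem' := by
    rintro X Y ⟨h1, h2⟩ ⟨h3, h4⟩
    constructor
    · rw [map_mul, mul_assoc, h3, ← mul_assoc, h1, mul_assoc]
    · rw [map_mul, mul_assoc, h4, ← mul_assoc, h2, mul_assoc]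
  add_mem' := by
    rintro X Y ⟨h1, h2⟩ ⟨h3, h4⟩
    constructor
    · rw [map_add, add_mul, mul_add, h1, h3]
    · rw [map_add, add_mul, mul_add, h2, h4]
  algebraMap_mem' := by
    intro r
    constructor
    · rw [AlgHom.commutes, Algebra.commutes]
    · rw [AlgHom.commutes, Algebra.commutes]

def mat (n : Fin 4 → M) : Matrix (Fin 4) (Fin 4) M :=
  !![n 0, D.α * D.σ (n 1), D.β * D.τ (n 2), D.β * D.α * D.τ D.κ * D.σ (D.τ (n 3));
     n 1, D.σ (n 0), D.β * D.τ (n 3), D.β * D.τ D.κ * D.σ (D.τ (n 2));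
     n 2, D.τ D.α * D.κ * D.σ (n 3), D.τ (n 0), D.τ D.α * D.σ (D.τ (n 1));
     n 3, D.κ * D.σ (n 2), D.τ (n 1), D.σ (D.τ (n 0))]

lemma rα' : D.α * D.τ D.κ * D.σ (D.τ D.κ) = D.τ D.α := by
  have := congrArg D.τ D.rα
  simpa [D.ττ, D.τσ] using this

lemma στα : D.σ (D.τ D.α) = D.τ D.α := by rw [← D.τσ, D.σα]

lemma mat_mem (n : Fin 4 → M) : D.mat n ∈ D.alg := by
  have h1 := D.rα
  have h2 := D.rβ
  have h3 := D.rα'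
  constructor
  · ext i j
    fin_cases i <;> fin_cases j <;> simp [Matrix.mul_apply, Fin.sum_univ_four, mat, Pu, D.σσ, D.ττ, D.τσ, D.σα, D.τβ, D.στα] <;> grind only
  · ext i j
    fin_cases i <;> fin_cases j <;> simp [Matrix.mul_apply, Fin.sum_univ_four, mat, Pv, D.σσ, D.ττ, D.τσ, D.σα, D.τβ, D.στα] <;> grind only

lemma eq_mat {X} (h : X ∈ D.alg) : X = D.mat (fun i => X i 0) := by
  obtain ⟨h1, h2⟩ := h
  have e1 : ∀ i, X i 1 = D.mat (fun i => X i 0) i 1 := by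
    intro i
    have := congrFun (congrFun h1 i) 0
    fin_cases i <;> simpa [Matrix.mul_apply, Fin.sum_univ_four, mat, Pu] using this
  have e2 : ∀ i, X i 2 = D.mat (fun i => X i 0) i 2 := by
    intro i
    have := congrFun (congrFun h2 i) 0
    fin_cases i <;> simpa [Matrix.mul_apply, Fin.sum_univ_four, mat, Pv] using this
  have e3 : ∀ i, X i 3 = D.mat (fun i => X i 0) i 3 := by
    intro i
    have := congrFun (congrFun h2 i) 1
    fin_cases i <;> simpa [Matrix.mul_apply, Fin.sum_univ_four, mat, Pv, e1, D.τσ, D.ττ, D.τβ, mul_assoc] using this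
  ext i j
  fin_cases j
  · fin_cases i <;> simp [mat]
  · exact e1 i
  · exact e2 i
  · exact e3 i

end CP
end PartE1

section PartE2
namespace CP
variable {K M : Type*} [Field K] [CommRing M] [Algebra K M] (D : CP K M)

lemma ext' {X Y : D.alg} (h : ∀ i, X.1 i 0 = Y.1 i 0) : X = Y := by
  apply Subtype.ext
  rw [D.eq_mat X.2, D.eq_mat Y.2]
  congr 1
  funext i
  exact h i

def el (n : Fin 4 → M) : D.alg := ⟨D.mat n, D.mat_mem n⟩

lemma el_col (n : Fin 4 → M) (i : Fin 4) : (D.el n).1 i 0 = n i := by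
  fin_cases i <;> simp [el, mat]

def equiv : D.alg ≃ₗ[K] (Fin 4 → M) where
  toFun X i := X.1 i 0
  invFun := D.el
  map_add' _ _ := rfl
  map_smul' _ _ := rfl
  left_inv X := D.ext' (fun i => D.el_col _ i)
  right_inv n := funext fun i => D.el_col _ i

lemma el_add (n n' : Fin 4 → M) : D.el n + D.el n' = D.el (n + n') := (D.equiv.symm.map_add n n').symm

lemma el_mul (n n' : Fin 4 → M) : D.el n * D.el n' = D.el (fun i => ∑ j, D.mat n i j * n' j) := by
  apply D.ext'
  intro i
  rw [D.el_col]
  change (D.mat n * D.mat n') i 0 = _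
  rw [Matrix.mul_apply]
  refine Finset.sum_congr rfl fun j _ => ?_
  congr 1
  exact D.el_col n' j

lemma eq_el (X : D.alg) : ∃ n, X = D.el n := ⟨D.equiv X, (D.equiv.left_inv X).symm⟩

lemma el_inj {n n' : Fin 4 → M} (h : D.el n = D.el n') : n = n' := D.equiv.symm.injective h

lemma one_el : (1 : D.alg) = D.el ![1, 0, 0, 0] := by
  apply D.ext'
  intro i
  rw [D.el_col]
  fin_cases i <;> simp [Matrix.one_apply]

structure Good (x y : M) : Prop where
  σx : D.σ x = x + 1
  σy : D.σ y = y
  τx : D.τ x = x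
  τy : D.τ y = y + 1
  two : (2 : M) = 0
  unit : ∀ m : M, m ≠ 0 → IsUnit m
  fix : ∀ m : M, D.σ m = m → D.τ m = m → ∃ p : K, m = algebraMap K M p
  αu : D.α ≠ 0
  βu : D.β ≠ 0
  κu : D.κ ≠ 0
  nt : (1 : M) ≠ 0

variable {D} {x y : M}

lemma Good.central (G : D.Good x y) : Algebra.IsCentral K D.alg := by
  constructor
  intro z hz
  rw [Subalgebra.mem_center_iff] at hz
  obtain ⟨n, rfl⟩ := D.eq_el z
  have h2 := G.two
  have hx := D.el_inj ((D.el_mul _ _).symm.trans ((hz (D.el ![x, 0, 0, 0])).trans (D.el_mul _ _)))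
  have hy := D.el_inj ((D.el_mul _ _).symm.trans ((hz (D.el ![y, 0, 0, 0])).trans (D.el_mul _ _)))
  have hu := D.el_inj ((D.el_mul _ _).symm.trans ((hz (D.el ![0, 1, 0, 0])).trans (D.el_mul _ _)))
  have hv := D.el_inj ((D.el_mul _ _).symm.trans ((hz (D.el ![0, 0, 1, 0])).trans (D.el_mul _ _)))
  have x1 := congrFun hx 1
  have x3 := congrFun hx 3
  have y2 := congrFun hy 2
  have u1 := congrFun hu 1
  have v1 := congrFun hv 2
  simp [Fin.sum_univ_four, mat, G.σx, G.τx, G.σy, G.τy] at x1 x3 y2 u1 v1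
  have n1 : n 1 = 0 := by linear_combination x1
  have n3 : n 3 = 0 := by linear_combination x3
  have n2 : n 2 = 0 := by linear_combination y2
  obtain ⟨p, hp⟩ := G.fix (n 0) u1.symm v1.symm
  rw [Algebra.mem_bot]
  refine ⟨p, ?_⟩
  apply D.ext'
  intro i
  rw [D.el_col]
  fin_cases i <;> simp [n1, n2, n3, hp, Matrix.algebraMap_matrix_apply]

lemma Good.simple (G : D.Good x y) : IsSimpleRing D.alg := by
  have h2 := G.two
  have nt := G.nt
  have : Nontrivial D.alg := ⟨0, 1, fun h => nt (by
    have := congrArg (fun X : D.alg => X.1 0 0) h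
    simpa using this.symm)⟩
  rw [isSimpleRing_iff_isTwoSided_imp]
  refine ⟨inferInstance, fun I hI => or_iff_not_imp_left.2 fun hne => ?_⟩
  obtain ⟨z, hz, hz0⟩ := Submodule.exists_mem_ne_zero_of_ne_bot hne
  obtain ⟨n, rfl⟩ := D.eq_el z
  have X : ∀ n, D.el n ∈ I → D.el ![0, n 1, 0, n 3] ∈ I := by
    intro n hn
    have := I.sub_mem (I.mul_mem_left (D.el ![x, 0, 0, 0]) hn) (I.mul_mem_right (D.el ![x, 0, 0, 0]) hn)
    rw [D.el_mul, D.el_mul] at this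
    convert this using 1
    rw [eq_sub_iff_add_eq, D.el_add]
    congr 1
    funext i
    fin_cases i <;> simp [Fin.sum_univ_four, mat, G.σx, G.τx, G.σy, G.τy] <;> ring
  have Y : ∀ n, D.el n ∈ I → D.el ![0, 0, n 2, n 3] ∈ I := by
    intro n hn
    have := I.sub_mem (I.mul_mem_left (D.el ![y, 0, 0, 0]) hn) (I.mul_mem_right (D.el ![y, 0, 0, 0]) hn)
    rw [D.el_mul, D.el_mul] at this
    convert this using 1
    rw [eq_sub_iff_add_eq, D.el_add]
    congr 1
    funext i
    fin_cases i <;> simp [Fin.sum_univ_four, mat, G.σx, G.τx, G.σy, G.τy] <;> ring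
  have m1 := X n hz
  have m2 := Y n hz
  have m3 : D.el ![0, 0, 0, n 3] ∈ I := by simpa using Y _ m1
  -- a nonzero diagonal element suffices
  have fin : ∀ m, m ≠ 0 → D.el ![m, 0, 0, 0] ∈ I → I = ⊤ := by
    intro m hm hmI
    obtain ⟨m', hm'⟩ := (G.unit m hm).exists_right_inv
    rw [Ideal.eq_top_iff_one]
    have := I.mul_mem_right (D.el ![m', 0, 0, 0]) hmI
    rw [D.el_mul] at this
    convert this using 1
    rw [D.one_el]
    congr 1
    funext i
    fin_cases i <;> simp [Fin.sum_univ_four, mat, hm']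
  have nz : ∀ a b : M, a ≠ 0 → b ≠ 0 → a * b ≠ 0 := by
    intro a b ha hb h
    exact ha ((G.unit b hb).mul_left_eq_zero.1 h)
  have hτκ : D.τ D.κ ≠ 0 := by
    intro h
    apply G.κu
    rw [← D.ττ D.κ, h, map_zero]
  by_cases n3 : n 3 = 0
  · by_cases n1 : n 1 = 0
    · by_cases n2 : n 2 = 0
      · have n0 : n 0 ≠ 0 := by
          intro n0
          apply hz0
          apply D.ext'
          intro i
          rw [D.el_col]
          fin_cases i <;> simp [n0, n1, n2, n3]
        refine fin _ n0 ?_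
        convert hz using 2
        funext i
        fin_cases i <;> simp [n1, n2, n3]
      · refine fin (D.β * n 2) (nz _ _ G.βu n2) ?_
        have := I.mul_mem_left (D.el ![0, 0, 1, 0]) m2
        rw [D.el_mul] at this
        convert this using 2
        funext i
        fin_cases i <;> simp [Fin.sum_univ_four, mat, n3]
    · refine fin (D.α * n 1) (nz _ _ G.αu n1) ?_
      have := I.mul_mem_left (D.el ![0, 1, 0, 0]) m1
      rw [D.el_mul] at this
      convert this using 2
      funext i
      fin_cases i <;> simp [Fin.sum_univ_four, mat, n3]
  · refine fin (D.β * D.α * D.τ D.κ * n 3) (nz _ _ (nz _ _ (nz _ _ G.βu G.αu) hτκ) n3) ?_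
    have := I.mul_mem_left (D.el ![0, 0, 0, 1]) m3
    rw [D.el_mul] at this
    convert this using 2
    funext i
    fin_cases i <;> simp [Fin.sum_univ_four, mat, n3]
end CP
end PartE2

section PartE3
open Polynomial in
lemma charpoly_coeff_isIntegral {R S : Type*} [CommRing R] [CommRing S] [Algebra R S]
    (A : Matrix (Fin 4) (Fin 4) S) (hA : IsIntegral R A) (i : ℕ) : IsIntegral R (A.charpoly.coeff i) := by
  obtain ⟨p, hp, hpA⟩ := hA
  refine Polynomial.isIntegral_coeff_of_dvd (p ^ 4) A.charpoly (hp.pow 4) A.charpoly_monic ?_ i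
  set P : S[X] := p.map (algebraMap R S) with hP
  have h0 : ∀ p : S[X], (X - C A) ∣ p.map (algebraMap S (Matrix (Fin 4) (Fin 4) S)) - C (aeval A p) := by
    intro p
    induction p using Polynomial.induction_on' with
    | add p q hp hq =>
      have := dvd_add hp hq
      rw [Polynomial.map_add, map_add, C_add]
      convert this using 1
      abel
    | monomial n r =>
      have h := ((commute_X (C A)).sub_dvd_pow_sub_pow n).mul_right (C (algebraMap S (Matrix (Fin 4) (Fin 4) S) r))
      convert h using 1
      rw [map_monomial, aeval_monomial, ← C_mul_X_pow_eq_monomial, Algebra.commutes, sub_mul, C_mul, C_pow, X_pow_mul]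
  have h1 := h0 P
  rw [show aeval A P = 0 by rw [hP, aeval_map_algebraMap]; exact hpA, C_0, sub_zero] at h1
  obtain ⟨c, h1⟩ := h1
  rw [← matPolyEquiv_smul_one, ← Matrix.matPolyEquiv_charmatrix] at h1
  have h2 : A.charmatrix * matPolyEquiv.symm c = P • 1 := by
    apply matPolyEquiv.injective
    rw [map_mul, AlgEquiv.apply_symm_apply, h1]
  have h3 := congrArg Matrix.det h2
  rw [Matrix.det_mul, Matrix.det_smul, Matrix.det_one, mul_one, Fintype.card_fin] at h3
  rw [Polynomial.map_pow, ← hP, ← h3]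
  exact dvd_mul_right _ _

/-- second coefficient -/
def q4 {S : Type*} [CommRing S] (A : Matrix (Fin 4) (Fin 4) S) : S :=
  (A 0 0 * A 1 1 - A 0 1 * A 1 0) + (A 0 0 * A 2 2 - A 0 2 * A 2 0) + (A 0 0 * A 3 3 - A 0 3 * A 3 0) +
  (A 1 1 * A 2 2 - A 1 2 * A 2 1) + (A 1 1 * A 3 3 - A 1 3 * A 3 1) + (A 2 2 * A 3 3 - A 2 3 * A 3 2)

lemma det_pair {S : Type*} [CommRing S] (A : Matrix (Fin 4) (Fin 4) S) {i j : Fin 4} (h : i ≠ j) :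
    (A.submatrix (Subtype.val : ({i, j} : Finset (Fin 4)) → Fin 4)
      (Subtype.val : ({i, j} : Finset (Fin 4)) → Fin 4)).det = A i i * A j j - A i j * A j i := by
  let f : Fin 2 → ({i, j} : Finset (Fin 4)) := ![⟨i, by simp⟩, ⟨j, by simp⟩]
  have hf : Function.Bijective f := by
    constructor
    · intro a b hab
      fin_cases a <;> fin_cases b <;> simp [f, h, h.symm] at hab ⊢
    · rintro ⟨a, ha⟩
      rcases Finset.mem_insert.1 ha with rfl | ha
      · exact ⟨0, rfl⟩
      · rw [Finset.mem_singleton] at ha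
        subst ha
        exact ⟨1, rfl⟩
  rw [← Matrix.det_submatrix_equiv_self (Equiv.ofBijective f hf), Matrix.det_fin_two]
  simp [f]

lemma q4_eq {S : Type*} [CommRing S] (A : Matrix (Fin 4) (Fin 4) S) : A.charpoly.coeff 2 = q4 A := by
  have h := A.charpoly_coeff_eq_sum_minors 2 (by simp)
  rw [show Fintype.card (Fin 4) - 2 = 2 by simp] at h
  rw [h]
  have e : (Finset.univ : Finset (Fin 4)).powersetCard 2 = {{0, 1}, {0, 2}, {0, 3}, {1, 2}, {1, 3}, {2, 3}} := by decide
  rw [e, Finset.sum_insert (by decide), Finset.sum_insert (by decide), Finset.sum_insert (by decide),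
    Finset.sum_insert (by decide), Finset.sum_insert (by decide), Finset.sum_singleton]
  rw [det_pair A (by decide), det_pair A (by decide), det_pair A (by decide), det_pair A (by decide),
    det_pair A (by decide), det_pair A (by decide)]
  simp only [q4]
  ring

def q4m (K : Type*) (S : Type*) [CommRing K] [CommRing S] [Algebra K S] :
    QuadraticMap K (Matrix (Fin 4) (Fin 4) S) S :=
  LinearMap.BilinMap.toQuadraticMap (LinearMap.mk₂ K (fun A B : Matrix (Fin 4) (Fin 4) S =>
    (A 0 0 * B 1 1 - A 0 1 * B 1 0) + (A 0 0 * B 2 2 - A 0 2 * B 2 0) + (A 0 0 * B 3 3 - A 0 3 * B 3 0) +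
    (A 1 1 * B 2 2 - A 1 2 * B 2 1) + (A 1 1 * B 3 3 - A 1 3 * B 3 1) + (A 2 2 * B 3 3 - A 2 3 * B 3 2))
    (by intros; simp only [Matrix.add_apply]; ring)
    (by intros; simp only [Matrix.smul_apply, Algebra.smul_def]; ring)
    (by intros; simp only [Matrix.add_apply]; ring)
    (by intros; simp only [Matrix.smul_apply, Algebra.smul_def]; ring))

lemma q4m_apply (K : Type*) {S : Type*} [CommRing K] [CommRing S] [Algebra K S]
    (A : Matrix (Fin 4) (Fin 4) S) : q4m K S A = q4 A := rfl
end PartE3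

section PartE4
lemma HAn.ne {K : Type*} [Field K] [CharP K 2] {t w c d : K} (h : HAn t w c d) :
    t ≠ 0 ∧ w ≠ 0 ∧ c ≠ 0 ∧ d ≠ 0 ∧ 1 + t ≠ 0 := by
  have h2 : (2 : K) = 0 := CharP.cast_eq_zero K 2
  have h := h.an
  refine ⟨?_, ?_, ?_, ?_, ?_⟩ <;> intro e
  · have := h 0 0 1 0 0 0 0 0 0 0 0 0 (by simp [nf, e]); simp at this
  · have := h 0 0 0 0 0 0 0 0 1 0 0 0 (by simp [nf, e]); simp at this
  · have := h 1 0 0 0 0 0 0 0 0 0 0 0 (by simp [nf, e]); simp at this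
  · have := h 0 0 0 0 1 0 0 0 0 0 0 0 (by simp [nf, e]); simp at this
  · have := h 1 0 1 0 0 0 0 0 0 0 0 0 (by simp [nf, e]); simp at this

def nA {K : Type*} [CommRing K] (a p q : K) : K := p ^ 2 + p * q + a * q ^ 2

lemma part1_iso {K : Type*} [Field K] (h2 : (2 : K) = 0) {t w : K} (ht : t ≠ 0) (p1 p2 R1 R2 : K) :
    nA ((1 + t) * w ^ 2) p1 p2 + t⁻¹ * nA ((1 + t) * w ^ 2) R1 R2 =
      nf w (p1 + w * R2) p2 + t * nf w ((R1 + t * w * p2) / t) (R2 / t) := by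
  simp only [nA, nf]
  field_simp
  grind

lemma part2_iso {K : Type*} [Field K] (h2 : (2 : K) = 0) {t w : K} (ht : t ≠ 0) (p1 p2 R1 R2 : K) :
    nA ((1 + t) * w ^ 2 / t) p1 p2 + t * nA ((1 + t) * w ^ 2 / t) R1 R2 =
      nf w (p1 + w * R2) p2 + t * nf w (R1 + w * p2 / t) R2 := by
  simp only [nA, nf]
  field_simp
  grind

lemma HAn.an' {K : Type*} [Field K] [CharP K 2] {t w c d : K} (h : HAn t w c d) {a b : K}
    (ha : a = (1 + t) * w ^ 2) (hb : b = a / t)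
    (p1 p2 r1 r2 p1' p2' r1' r2' p1'' p2'' r1'' r2'' : K)
    (h0 : c * (nA a p1 p2 + b * nA a r1 r2) + d * (nA b p1' p2' + a * nA b r1' r2') +
      c * d * w * (nA a p1'' p2'' + (a + b) * nA a r1'' r2'') = 0) :
    (p1 = 0 ∧ p2 = 0 ∧ r1 = 0 ∧ r2 = 0) ∧ (p1' = 0 ∧ p2' = 0 ∧ r1' = 0 ∧ r2' = 0) ∧
    (p1'' = 0 ∧ p2'' = 0 ∧ r1'' = 0 ∧ r2'' = 0) := by
  have h2 : (2 : K) = 0 := CharP.cast_eq_zero K 2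
  obtain ⟨ht, hw, hc, hd, ht1⟩ := h.ne
  have ha0 : a ≠ 0 := by rw [ha]; positivity
  have hb0 : b ≠ 0 := by rw [hb]; exact div_ne_zero ha0 ht
  have e1 : nA a p1 p2 + b * nA a r1 r2 = nA a p1 p2 + t⁻¹ * nA a (a * r2) (r1 + r2) := by
    simp only [nA, hb]; field_simp; grind
  have e2 : nA b p1' p2' + a * nA b r1' r2' = nA b p1' p2' + t * nA b (b * r2') (r1' + r2') := by
    have : a = t * b := by rw [hb]; field_simp
    rw [this]
    simp only [nA]; grind
  have e3 : nA a p1'' p2'' + (a + b) * nA a r1'' r2'' =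
      nA a p1'' p2'' + t⁻¹ * nA a ((1 + t) * w * r1'') ((1 + t) * w * r2'') := by
    simp only [nA, hb, ha]; field_simp; grind
  have hb' : b = (1 + t) * w ^ 2 / t := by rw [hb, ha]
  rw [e1, e2, e3, hb', ha, part1_iso h2 ht, part1_iso h2 ht, part2_iso h2 ht] at h0
  rw [← hb', ← ha] at h0
  obtain ⟨⟨a1, a2, a3, a4⟩, ⟨b1, b2, b3, b4⟩, ⟨c1, c2, c3, c4⟩⟩ := h.an _ _ _ _ _ _ _ _ _ _ _ _ h0
  subst a2 b2 c2
  have a4' : r1 + r2 = 0 := by simpa [ht] using a4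
  have c4' : r2'' = 0 := by simpa [ht, ht1, hw] using c4
  have c3' : r1'' = 0 := by simpa [ht, ht1, hw] using c3
  have a3' : r2 = 0 := by simpa [ht, ha0] using a3
  have b3' : r2' = 0 := by simpa [ht, hb0] using b3
  subst a3' b3' c3' c4'
  simp only [add_zero] at a4' b4
  subst a4' b4
  simp at a1 b1 c1
  simp [a1, b1, c1]
end PartE4

section PartE5
section
variable {M : Type*} [CommRing M]
lemma crd1 (h2 : (2 : M) = 0) {x y a b : M} (hx : x ^ 2 = x + a) (hy : y ^ 2 = y + b) (c p q r s : M) :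
    c * (y + 1) * (p + q * x + r * y + s * (x * y)) * (p + q * (x + 1) + r * y + s * ((x + 1) * y)) +
    c * y * (p + q * x + r * (y + 1) + s * (x * (y + 1))) * (p + q * (x + 1) + r * (y + 1) + s * ((x + 1) * (y + 1)))
    = c * (nA a p q + b * nA a r s) := by
  obtain rfl : a = x ^ 2 + x := by grind
  obtain rfl : b = y ^ 2 + y := by grind
  simp only [nA]
  grind

lemma crd2 (h2 : (2 : M) = 0) {x y a b : M} (hx : x ^ 2 = x + a) (hy : y ^ 2 = y + b) (c p q r s : M) :
    c * (x + 1) * (p + q * x + r * y + s * (x * y)) * (p + q * x + r * (y + 1) + s * (x * (y + 1))) +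
    c * x * (p + q * (x + 1) + r * y + s * ((x + 1) * y)) * (p + q * (x + 1) + r * (y + 1) + s * ((x + 1) * (y + 1)))
    = c * (nA b p r + a * nA b q s) := by
  obtain rfl : a = x ^ 2 + x := by grind
  obtain rfl : b = y ^ 2 + y := by grind
  simp only [nA]
  grind

lemma crd3 (h2 : (2 : M) = 0) {x y a b : M} (hx : x ^ 2 = x + a) (hy : y ^ 2 = y + b) (c p q r s : M) :
    c * (x + y + 1) * (p + q * x + r * y + s * (x * y)) * (p + q * (x + 1) + r * (y + 1) + s * ((x + 1) * (y + 1))) +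
    c * (x + y) * (p + q * (x + 1) + r * y + s * ((x + 1) * y)) * (p + q * x + r * (y + 1) + s * (x * (y + 1)))
    = c * (nA a (p + a * s) (q + r + s) + (a + b) * nA a r s) := by
  obtain rfl : a = x ^ 2 + x := by grind
  obtain rfl : b = y ^ 2 + y := by grind
  simp only [nA]
  grind
end

section
variable {K M : Type*} [Field K] [CommRing M] [Algebra K M] {a b : K}

def Biq.cp (Q : Biq K M a b) (h2 : (2 : M) = 0) (c d v : K) (hv : v ^ 2 * (a * b * (a + b)) = 1) : CP K M where
  σ := Q.σ
  τ := Q.τ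
  α := algebraMap K M c * (Q.y + 1)
  β := algebraMap K M d * (Q.x + 1)
  κ := algebraMap K M v * (Q.x * (Q.y + 1) * (Q.x + Q.y))
  σσ m := by
    obtain ⟨p, q, r, s, rfl⟩ := Q.span m
    simp [Q.σx, Q.σy]
    grind
  ττ m := by
    obtain ⟨p, q, r, s, rfl⟩ := Q.span m
    simp [Q.τx, Q.τy]
    grind
  τσ m := by
    obtain ⟨p, q, r, s, rfl⟩ := Q.span m
    simp [Q.τx, Q.τy, Q.σx, Q.σy]
  σα := by simp [Q.σy]
  τβ := by simp [Q.τx]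
  rα := by
    have hx := Q.hx
    have hy := Q.hy
    have h := congrArg (algebraMap K M) hv
    simp only [map_mul, map_pow, map_add, map_one] at h
    simp [Q.τx, Q.τy, Q.σx, Q.σy]
    have e1 : algebraMap K M a = Q.x * (Q.x + 1) := by grind
    have e2 : algebraMap K M b = Q.y * (Q.y + 1) := by grind
    have e3 : algebraMap K M a + algebraMap K M b = (Q.x + Q.y) * (Q.x + Q.y + 1) := by grind
    rw [e3, e1, e2] at h
    have e4 : Q.y + 1 + 1 = Q.y := by grind
    rw [e4]
    linear_combination algebraMap K M c * (Q.y + 1) * h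
  rβ := by
    have hx := Q.hx
    have hy := Q.hy
    have h := congrArg (algebraMap K M) hv
    simp only [map_mul, map_pow, map_add, map_one] at h
    simp [Q.τx, Q.τy, Q.σx, Q.σy]
    have e1 : algebraMap K M a = Q.x * (Q.x + 1) := by grind
    have e2 : algebraMap K M b = Q.y * (Q.y + 1) := by grind
    have e3 : algebraMap K M a + algebraMap K M b = (Q.x + Q.y) * (Q.x + Q.y + 1) := by grind
    rw [e3, e1, e2] at h
    have e4 : Q.y + 1 + 1 = Q.y := by grind
    have e5 : Q.x + 1 + 1 = Q.x := by grind
    rw [e4, e5]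
    linear_combination - algebraMap K M d * Q.x * h

lemma CP.q4mat (D : CP K M) (n : Fin 4 → M) : q4 (D.mat n) = n 0 * D.σ (n 0) + n 0 * D.τ (n 0) + n 0 * D.σ (D.τ (n 0)) +
      D.σ (n 0) * D.τ (n 0) + D.σ (n 0) * D.σ (D.τ (n 0)) + D.τ (n 0) * D.σ (D.τ (n 0)) -
      (D.α * n 1 * D.σ (n 1) + D.τ D.α * D.τ (n 1) * D.σ (D.τ (n 1))) -
      (D.β * n 2 * D.τ (n 2) + D.σ D.β * D.σ (n 2) * D.σ (D.τ (n 2))) -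
      (D.β * D.α * D.τ D.κ * n 3 * D.σ (D.τ (n 3)) + D.β * D.τ D.α * D.κ * D.σ (n 3) * D.τ (n 3)) := by
  simp only [q4, CP.mat, Matrix.of_apply, Matrix.cons_val]
  rw [D.rβ]
  ring

lemma Biq.q4mat (Q : Biq K M a b) (h2 : (2 : M) = 0) (c d v w : K) (hv : v ^ 2 * (a * b * (a + b)) = 1)
    (hw : v * (a * b) = w) (n : Fin 4 → M) (p q r s : Fin 4 → K)
    (hn : ∀ i, n i = algebraMap K M (p i) + algebraMap K M (q i) * Q.x + algebraMap K M (r i) * Q.y +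
    algebraMap K M (s i) * (Q.x * Q.y)) :
    q4 ((Q.cp h2 c d v hv).mat n) = n 0 * Q.σ (n 0) + n 0 * Q.τ (n 0) + n 0 * Q.σ (Q.τ (n 0)) +
      Q.σ (n 0) * Q.τ (n 0) + Q.σ (n 0) * Q.σ (Q.τ (n 0)) + Q.τ (n 0) * Q.σ (Q.τ (n 0)) +
     algebraMap K M (c * (nA a (p 1) (q 1) + b * nA a (r 1) (s 1)) + d * (nA b (p 2) (r 2) + a * nA b (q 2) (s 2)) +
      c * d * w * (nA a (p 3 + a * s 3) (q 3 + r 3 + s 3) + (a + b) * nA a (r 3) (s 3))) := by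
  have hx := Q.hx
  have hy := Q.hy
  have h := congrArg (algebraMap K M) hw
  simp only [map_mul] at h
  have f1 : algebraMap K M a = Q.x * (Q.x + 1) := by grind
  have f2 : algebraMap K M b = Q.y * (Q.y + 1) := by grind
  have e4 : Q.y + 1 + 1 = Q.y := by grind
  have e5 : Q.x + 1 + 1 = Q.x := by grind
  have e1 := crd1 h2 hx hy (algebraMap K M c) (algebraMap K M (p 1)) (algebraMap K M (q 1)) (algebraMap K M (r 1)) (algebraMap K M (s 1))
  have e2 := crd2 h2 hx hy (algebraMap K M d) (algebraMap K M (p 2)) (algebraMap K M (q 2)) (algebraMap K M (r 2)) (algebraMap K M (s 2))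
  have e3 := crd3 h2 hx hy (algebraMap K M c * algebraMap K M d * algebraMap K M w) (algebraMap K M (p 3)) (algebraMap K M (q 3)) (algebraMap K M (r 3)) (algebraMap K M (s 3))
  have hnA : ∀ a p q : K, algebraMap K M (nA a p q) = nA (algebraMap K M a) (algebraMap K M p) (algebraMap K M q) := by
    intros; simp [nA]
  simp only [map_add, map_mul, hnA]
  rw [← e1, ← e2, ← e3]
  rw [CP.q4mat]
  simp only [Biq.cp, map_mul, map_add, map_one, Q.σx, Q.σy, Q.τx, Q.τy, AlgHom.commutes, e4, e5]
  rw [← h, f1, f2]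
  have hs : ∀ z : M, - z = z := fun z => by linear_combination (- z) * h2
  simp only [sub_eq_add_neg, hs]
  rw [hn 1, hn 2, hn 3]
  simp only [map_mul, map_add, map_one, Q.σx, Q.σy, Q.τx, Q.τy, AlgHom.commutes, e4, e5]
  ring
end
end PartE5

section PartE6
section
variable {K M : Type*} [Field K] [CommRing M] [Algebra K M] {a b : K}

lemma Biq.fix (Q : Biq K M a b) (m : M) (h1 : Q.σ m = m) (h2 : Q.τ m = m) : ∃ p : K, m = algebraMap K M p := by
  obtain ⟨p, q, r, s, rfl⟩ := Q.span m
  simp only [map_mul, map_add, map_one, Q.σx, Q.σy, Q.τx, Q.τy, AlgHom.commutes] at h1 h2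
  obtain ⟨h3, -, h4, -⟩ := Q.ind q 0 s 0 (by simp; linear_combination h1)
  obtain ⟨h5, -, h6, -⟩ := Q.ind r s 0 0 (by simp; linear_combination h2)
  exact ⟨p, by simp [h3, h4, h5]⟩

noncomputable def Biq.lin (Q : Biq K M a b) : (Fin 4 → K) ≃ₗ[K] M :=
  LinearEquiv.ofBijective
    { toFun := fun v => algebraMap K M (v 0) + algebraMap K M (v 1) * Q.x + algebraMap K M (v 2) * Q.y +
        algebraMap K M (v 3) * (Q.x * Q.y)
      map_add' := fun v w => by simp; ring
      map_smul' := fun v w => by simp [Algebra.smul_def]; ring }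
    (by
      constructor
      · rw [← LinearMap.ker_eq_bot, LinearMap.ker_eq_bot']
        intro v hv
        obtain ⟨h1, h2, h3, h4⟩ := Q.ind _ _ _ _ hv
        ext i
        fin_cases i <;> assumption
      · intro m
        obtain ⟨p, q, r, s, h⟩ := Q.span m
        exact ⟨![p, q, r, s], by simp [h]⟩)

lemma Biq.finrank (Q : Biq K M a b) : Module.finrank K M = 4 := by
  rw [← Q.lin.finrank_eq]; simp

lemma Biq.finite (Q : Biq K M a b) : Module.Finite K M := Module.Finite.equiv Q.lin

lemma Biq.alg_inj (Q : Biq K M a b) {p : K} (h : algebraMap K M p = 0) : p = 0 :=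
  (Q.ind p 0 0 0 (by simp [h])).1

lemma Biq.unit [CharP K 2] (Q : Biq K M a b) {t w c d : K} (H : HAn t w c d)
    (ha : a = (1 + t) * w ^ 2) (hb : b = a / t) (h2 : (2 : M) = 0) (m : M) (hm : m ≠ 0) : IsUnit m := by
  obtain ⟨ht, hw, hc, hd, ht1⟩ := H.ne
  have hx := Q.hx
  have hy := Q.hy
  have hnA : ∀ a p q : K, algebraMap K M (nA a p q) = nA (algebraMap K M a) (algebraMap K M p) (algebraMap K M q) := by
    intros; simp [nA]
  have hσ : ∀ m : M, m * Q.σ m = 0 → m = 0 := by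
    intro m hm
    obtain ⟨p, q, r, s, rfl⟩ := Q.span m
    have hm' := congrArg Q.τ hm
    have e1 := crd1 h2 hx hy (algebraMap K M c) (algebraMap K M p) (algebraMap K M q) (algebraMap K M r) (algebraMap K M s)
    simp only [map_mul, map_add, map_one, Q.σx, Q.σy, Q.τx, Q.τy, AlgHom.commutes, map_zero] at hm hm'
    rw [mul_assoc, mul_assoc (_ * _), hm, hm', mul_zero, mul_zero, add_zero, ← hnA, ← hnA, ← map_mul, ← map_add, ← map_mul] at e1
    obtain ⟨⟨h1, h2, h3, h4⟩, -⟩ := H.an' ha hb p q r s 0 0 0 0 0 0 0 0 (by rw [Q.alg_inj e1.symm]; simp [nA])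
    simp [h1, h2, h3, h4]
  have hτ : ∀ m : M, m * Q.τ m = 0 → m = 0 := by
    intro m hm
    obtain ⟨p, q, r, s, rfl⟩ := Q.span m
    have hm' := congrArg Q.σ hm
    have e1 := crd2 h2 hx hy (algebraMap K M d) (algebraMap K M p) (algebraMap K M q) (algebraMap K M r) (algebraMap K M s)
    simp only [map_mul, map_add, map_one, Q.σx, Q.σy, Q.τx, Q.τy, AlgHom.commutes, map_zero] at hm hm'
    rw [mul_assoc, mul_assoc (_ * _), hm, hm', mul_zero, mul_zero, add_zero, ← hnA, ← hnA, ← map_mul, ← map_add, ← map_mul] at e1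
    obtain ⟨-, ⟨h1, h2, h3, h4⟩, -⟩ := H.an' ha hb 0 0 0 0 p r q s 0 0 0 0 (by
      have := Q.alg_inj e1.symm
      simpa [nA] using this)
    simp [h1, h2, h3, h4]
  have h3 : (m * Q.σ m) * Q.τ (m * Q.σ m) ≠ 0 := fun h => hm (hσ _ (hτ _ h))
  have hσσ : ∀ m, Q.σ (Q.σ m) = m := by
    intro m
    obtain ⟨p, q, r, s, rfl⟩ := Q.span m
    simp [Q.σx, Q.σy]
    grind
  have hττ : ∀ m, Q.τ (Q.τ m) = m := by
    intro m
    obtain ⟨p, q, r, s, rfl⟩ := Q.span m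
    simp [Q.τx, Q.τy]
    grind
  have hτσ : ∀ m, Q.τ (Q.σ m) = Q.σ (Q.τ m) := by
    intro m
    obtain ⟨p, q, r, s, rfl⟩ := Q.span m
    simp [Q.τx, Q.τy, Q.σx, Q.σy]
  obtain ⟨p, hp⟩ := Q.fix ((m * Q.σ m) * Q.τ (m * Q.σ m))
    (by simp only [map_mul, hσσ, hττ, hτσ]; ring) (by simp only [map_mul, hσσ, hττ, hτσ]; ring)
  have hp0 : p ≠ 0 := by
    rintro rfl
    apply h3
    rw [hp, map_zero]
  have hu : IsUnit ((m * Q.σ m) * Q.τ (m * Q.σ m)) := by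
    rw [hp]
    exact (IsUnit.mk0 p hp0).map (algebraMap K M)
  exact isUnit_of_mul_isUnit_left (isUnit_of_mul_isUnit_left hu)
end

lemma sub_surj {K V M : Type*} [Field K] [AddCommGroup V] [Module K V] [AddCommGroup M] [Module K M]
    [Module.Finite K V] [Module.Finite K M] (W : Submodule K V) (f : V →ₗ[K] M)
    (h : Module.finrank K W = Module.finrank K M) (hf : Function.Injective (f.domRestrict W)) :
    Function.Surjective (f.domRestrict W) :=
  (LinearMap.injective_iff_surjective_of_finrank_eq_finrank h).1 hf

lemma main_alg (K : Type u) [Field K] [CharP K 2] (t w c d : K) (H : HAn t w c d) :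
    ∃ (M : Type u) (_ : CommRing M) (_ : Algebra K M) (A : Subalgebra K (Matrix (Fin 4) (Fin 4) M)),
      Nontrivial M ∧ Module.finrank K A = 16 ∧ Algebra.IsCentral K A ∧ IsSimpleRing A ∧
      (∀ X ∈ A, ∃ v : K, q4 X = algebraMap K M v) ∧
      (∀ W : Submodule K A, Module.finrank K W = 4 → (∀ X ∈ W, q4 X.1 = 0) → False) := by
  obtain ⟨ht, hw, hc, hd, ht1⟩ := H.ne
  obtain ⟨a, ha⟩ : ∃ a, a = (1 + t) * w ^ 2 := ⟨_, rfl⟩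
  obtain ⟨b, hb⟩ : ∃ b, b = a / t := ⟨_, rfl⟩
  obtain ⟨M, _, _, ⟨Q⟩⟩ := Biq.exists K a b
  have k2 : (2 : K) = 0 := CharP.cast_eq_zero K 2
  have h2 : (2 : M) = 0 := by rw [← map_ofNat (algebraMap K M) 2, k2, map_zero]
  have hs : ∀ z : M, - z = z := fun z => by linear_combination (- z) * h2
  have hv : (t / ((1 + t) ^ 2 * w ^ 3)) ^ 2 * (a * b * (a + b)) = 1 := by
    rw [hb, ha]; field_simp; ring
  have hw' : (t / ((1 + t) ^ 2 * w ^ 3)) * (a * b) = w := by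
    rw [hb, ha]; field_simp
  have nt : (1 : M) ≠ 0 := by
    intro h
    have := Q.ind 1 0 0 0 (by simp [h])
    simp at this
  have hun := Q.unit H ha hb h2
  have ha0 : a ≠ 0 := by rw [ha]; positivity
  have hb0 : b ≠ 0 := by rw [hb]; exact div_ne_zero ha0 ht
  generalize hvv : t / ((1 + t) ^ 2 * w ^ 3) = v at hv hw'
  have hv0 : v ≠ 0 := by rintro rfl; simp at hv
  let D := Q.cp h2 c d v hv
  have hx := Q.hx
  have hy := Q.hy
  have hDσ : D.σ = Q.σ := rfl
  have hDτ : D.τ = Q.τ := rfl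
  have : Nontrivial M := ⟨⟨1, 0, nt⟩⟩
  have u : ∀ {p : K}, p ≠ 0 → IsUnit (algebraMap K M p) := fun hp => (IsUnit.mk0 _ hp).map (algebraMap K M)
  have ux : IsUnit (Q.x * (Q.x + 1)) := by
    rw [show Q.x * (Q.x + 1) = algebraMap K M a by grind]; exact u ha0
  have uy : IsUnit (Q.y * (Q.y + 1)) := by
    rw [show Q.y * (Q.y + 1) = algebraMap K M b by grind]; exact u hb0
  have uz : IsUnit ((Q.x + Q.y)) := by
    apply hun
    intro h
    have := Q.ind 0 1 1 0 (by simp [h])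
    simp at this
  have G : D.Good Q.x Q.y :=
    { σx := Q.σx
      σy := Q.σy
      τx := Q.τx
      τy := Q.τy
      two := h2
      unit := hun
      fix := Q.fix
      αu := ((u hc).mul (isUnit_of_mul_isUnit_right uy)).ne_zero
      βu := ((u hd).mul (isUnit_of_mul_isUnit_right ux)).ne_zero
      κu := ((u hv0).mul (((isUnit_of_mul_isUnit_left ux).mul (isUnit_of_mul_isUnit_right uy)).mul uz)).ne_zero
      nt := nt }
  have := Q.finite
  refine ⟨M, inferInstance, inferInstance, D.alg, inferInstance, ?_, G.central, G.simple, ?_, ?_⟩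
  · rw [D.equiv.finrank_eq, Module.finrank_pi_fintype]
    simp [Q.finrank]
  · intro X hX
    obtain ⟨n, hn⟩ := D.eq_el ⟨X, hX⟩
    obtain rfl : X = D.mat n := congrArg Subtype.val hn
    choose p q r s h using fun i => Q.span (n i)
    rw [Q.q4mat h2 c d v w hv hw' n p q r s h, ← hDσ, ← hDτ]
    obtain ⟨e, he⟩ := Q.fix (n 0 * Q.σ (n 0) + n 0 * Q.τ (n 0) + n 0 * Q.σ (Q.τ (n 0)) +
      Q.σ (n 0) * Q.τ (n 0) + Q.σ (n 0) * Q.σ (Q.τ (n 0)) + Q.τ (n 0) * Q.σ (Q.τ (n 0)))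
      (by rw [← hDσ, ← hDτ]; simp only [map_add, map_mul, D.σσ, D.ττ, D.τσ]; ring)
      (by rw [← hDσ, ← hDτ]; simp only [map_add, map_mul, D.σσ, D.ττ, D.τσ]; ring)
    rw [hDσ, hDτ, he, ← map_add]
    exact ⟨_, rfl⟩
  · intro W hW hq
    -- projection
    let π : D.alg →ₗ[K] M := (LinearMap.proj 0).comp D.equiv.toLinearMap
    have hπ : ∀ n, π (D.el n) = n 0 := fun n => D.el_col n 0
    have key : ∀ n, q4 (D.mat n) = 0 → (n 0 = 0 ∨ n 0 = 1) → n 1 = 0 ∧ n 2 = 0 ∧ n 3 = 0 := by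
      intro n h0 h1
      choose p q r s h using fun i => Q.span (n i)
      rw [Q.q4mat h2 c d v w hv hw' n p q r s h] at h0
      have h3 : n 0 * Q.σ (n 0) + n 0 * Q.τ (n 0) + n 0 * Q.σ (Q.τ (n 0)) +
        Q.σ (n 0) * Q.τ (n 0) + Q.σ (n 0) * Q.σ (Q.τ (n 0)) + Q.τ (n 0) * Q.σ (Q.τ (n 0)) = 0 := by
        rcases h1 with h1 | h1 <;> rw [h1] <;> simp
        linear_combination 3 * h2
      rw [h3, zero_add] at h0
      obtain ⟨⟨a1, a2, a3, a4⟩, ⟨b1, b2, b3, b4⟩, ⟨c1, c2, c3, c4⟩⟩ := H.an' ha hb _ _ _ _ _ _ _ _ _ _ _ _ (Q.alg_inj h0)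
      rw [c3, c4, add_zero, add_zero] at c2
      rw [c4, mul_zero, add_zero] at c1
      rw [h 1, h 2, h 3]
      simp [a1, a2, a3, a4, b1, b2, b3, b4, c1, c2, c3, c4]
    have inj : Function.Injective (π.domRestrict W) := by
      refine (injective_iff_map_eq_zero _).2 ?_
      rintro ⟨X, hX⟩ h
      obtain ⟨n, rfl⟩ := D.eq_el X
      have h : n 0 = 0 := (hπ n).symm.trans h
      obtain ⟨a1, a2, a3⟩ := key n (hq _ hX) (Or.inl h)
      have : n = 0 := by ext i; fin_cases i <;> assumption
      subst this
      exact Subtype.ext (D.equiv.symm.map_zero)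
    have : Module.Finite K D.alg := Module.Finite.equiv D.equiv.symm
    have surj : Function.Surjective (π.domRestrict W) :=
      sub_surj W π (by rw [hW, Q.finrank]) inj
    obtain ⟨⟨X, hX⟩, h⟩ := surj 1
    obtain ⟨n, rfl⟩ := D.eq_el X
    have h : n 0 = 1 := (hπ n).symm.trans h
    obtain ⟨a1, a2, a3⟩ := key n (hq _ hX) (Or.inr h)
    have hn : n = ![1, 0, 0, 0] := by ext i; fin_cases i <;> assumption
    subst hn
    obtain ⟨⟨Y, hY⟩, h'⟩ := surj (Q.x * Q.y)
    obtain ⟨n, rfl⟩ := D.eq_el Y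
    have h' : n 0 = Q.x * Q.y := (hπ n).symm.trans h'
    have e1 := hq _ hX
    have e2 := hq _ hY
    have e3 := hq _ (W.add_mem hX hY)
    rw [← D.one_el] at e1 e3
    have e4 : q4 (1 + D.mat n) = 0 := e3
    have e5 : q4 (D.mat n) = 0 := e2
    have e6 : q4 (1 + D.mat n) = q4 (D.mat n) + 6 + 3 * (D.mat n 0 0 + D.mat n 1 1 + D.mat n 2 2 + D.mat n 3 3) := by
      simp [q4]; ring
    have e7 : D.mat n 0 0 + D.mat n 1 1 + D.mat n 2 2 + D.mat n 3 3 = n 0 + Q.σ (n 0) + Q.τ (n 0) + Q.σ (Q.τ (n 0)) := by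
      simp [CP.mat, hDσ, hDτ]
    rw [e4, e5, e7, h'] at e6
    simp only [map_mul, map_add, map_one, Q.σx, Q.σy, Q.τx, Q.τy] at e6
    apply nt
    linear_combination (-1) * e6 - (4 + 6 * Q.x * Q.y + 3 * Q.x + 3 * Q.y) * h2
end PartE6

section PartG1
open scoped TensorProduct

lemma li_baseChange {E E' K B : Type*} [Field E] [Field E'] [Field K] [Algebra E E'] [Algebra E' K]
    [Algebra E K] [IsScalarTower E E' K] [AddCommGroup B] [Module E B] [Module.Finite E B]
    (φ : E' ⊗[E] B →+ K ⊗[E] B) (hφ : ∀ x y, φ (x ⊗ₜ y) = algebraMap E' K x ⊗ₜ y) {n : ℕ}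
    (v : Fin n → E' ⊗[E] B) (hv : LinearIndependent E' v) : LinearIndependent K (fun i => φ (v i)) := by
  let b := Module.finBasis E B
  let b1 := b.baseChange E'
  let b2 := b.baseChange K
  have h1 : LinearIndependent E' (fun i => b1.equivFun (v i)) := by
    simpa [Function.comp_def] using hv.map' b1.equivFun.toLinearMap (LinearEquiv.ker _)
  have h2 := (linearIndependent_algebraMap_comp_iff (S := K)).2 h1
  have h3 : ∀ z, algebraMap E' K ∘ b1.equivFun z = b2.equivFun (φ z) := by
    intro z
    induction z using TensorProduct.induction_on with
    | zero => ext; simp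
    | tmul x y =>
      ext i
      simp [hφ, b1, b2, Algebra.smul_def, ← IsScalarTower.algebraMap_apply]
    | add x y hx hy =>
      rw [map_add, map_add, map_add, ← hx, ← hy]
      ext i
      simp
  simp only [h3] at h2
  exact LinearIndependent.of_comp b2.equivFun.toLinearMap h2

lemma span_iso {K V N : Type*} [Field K] [AddCommGroup V] [Module K V] [AddCommGroup N] [Module K N]
    (Q : QuadraticMap K V N) {n : ℕ} (v : Fin n → V) (h1 : ∀ i, Q (v i) = 0) (h2 : ∀ i j, Q (v i + v j) = 0)
    (x : V) (hx : x ∈ Submodule.span K (Set.range v)) : Q x = 0 := by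
  have hp : ∀ i j, QuadraticMap.polar Q (v i) (v j) = 0 := by
    intro i j
    simp [QuadraticMap.polar, h1, h2]
  have hp' : ∀ x ∈ Submodule.span K (Set.range v), ∀ j, QuadraticMap.polar Q x (v j) = 0 := by
    intro x hx j
    induction hx using Submodule.span_induction with
    | mem x h => obtain ⟨i, rfl⟩ := h; exact hp i j
    | zero => simp
    | add x y _ _ h h' => rw [QuadraticMap.polar_add_left, h, h', add_zero]
    | smul a x _ h => rw [QuadraticMap.polar_smul_left, h, smul_zero]
  have hp'' : ∀ x ∈ Submodule.span K (Set.range v), ∀ y ∈ Submodule.span K (Set.range v), QuadraticMap.polar Q x y = 0 := by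
    intro x hx y hy
    induction hy using Submodule.span_induction with
    | mem y h => obtain ⟨i, rfl⟩ := h; exact hp' x hx i
    | zero => simp
    | add y z _ _ h h' => rw [QuadraticMap.polar_add_right, h, h', add_zero]
    | smul a y _ h => rw [QuadraticMap.polar_smul_right, h, smul_zero]
  induction hx using Submodule.span_induction with
  | mem x h => obtain ⟨i, rfl⟩ := h; exact h1 i
  | zero => simp
  | add x y hx hy h h' => rw [QuadraticMap.map_add (⇑Q), h, h', hp'' x hx y hy, add_zero, add_zero]
  | smul a x _ h => rw [QuadraticMap.map_smul, h, smul_zero]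

lemma glue {E E' K B M : Type*} [Field E] [Field E'] [Field K] [Algebra E E'] [Algebra E' K]
    [Algebra E K] [IsScalarTower E E' K] [Ring B] [Algebra E B] (hB : Module.finrank E B = 16)
    [CommRing M] [Nontrivial M] [Algebra K M] [Algebra E' M] [IsScalarTower E' K M]
    (A : Subalgebra K (Matrix (Fin 4) (Fin 4) M)) (hA : ∀ X ∈ A, ∃ v : K, q4 X = algebraMap K M v)
    (e : (K ⊗[E] B) ≃ₐ[K] A) (hq : QP E' 8) (hcl : ∀ x : K, IsIntegral E' x → ∃ y, x = algebraMap E' K y) :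
    ∃ W : Submodule K A, Module.finrank K W = 4 ∧ ∀ X ∈ W, q4 X.1 = 0 := by
  have : Module.Finite E B := Module.finite_of_finrank_pos (by omega)
  let φ : E' ⊗[E] B →ₐ[E] K ⊗[E] B := Algebra.TensorProduct.map (IsScalarTower.toAlgHom E E' K) (AlgHom.id E B)
  have hφ : ∀ x y, φ (x ⊗ₜ y) = algebraMap E' K x ⊗ₜ y := fun x y => by simp [φ]
  let ψ0 : E' ⊗[E] B →+* Matrix (Fin 4) (Fin 4) M := (A.val.toRingHom.comp e.toAlgHom.toRingHom).comp φ.toRingHom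
  have hψ0 : ∀ v, ψ0 v = (e (φ v)).1 := fun v => rfl
  let ψ : E' ⊗[E] B →ₐ[E'] Matrix (Fin 4) (Fin 4) M :=
    { ψ0 with
      commutes' := by
        intro r
        change ψ0 _ = _
        rw [hψ0, Algebra.TensorProduct.algebraMap_apply, hφ]
        have : (algebraMap E' K r) ⊗ₜ[E] (1 : B) = algebraMap K (K ⊗[E] B) (algebraMap E' K r) := by
          rw [Algebra.TensorProduct.algebraMap_apply]; simp
        simp only [Algebra.algebraMap_self, RingHom.id_apply]
        rw [this, AlgEquiv.commutes, IsScalarTower.algebraMap_apply E' K (Matrix (Fin 4) (Fin 4) M)]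
        rfl }
  have hψ : ∀ v, ψ v = (e (φ v)).1 := fun v => rfl
  have hinj : Function.Injective (algebraMap E' M) := (algebraMap E' M).injective
  obtain ⟨l, hl⟩ := LinearMap.exists_leftInverse_of_injective (Algebra.linearMap E' M)
    (LinearMap.ker_eq_bot.2 hinj)
  let Q : QuadraticForm E' (E' ⊗[E] B) := l.compQuadraticMap ((q4m E' M).comp ψ.toLinearMap)
  have hQ : ∀ v, Q v = l (q4 (ψ v)) := fun v => rfl
  have hval : ∀ v, Q v = 0 → q4 (ψ v) = 0 := by
    intro v hv
    have i1 : IsIntegral E' v := Algebra.IsIntegral.isIntegral v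
    have i2 : IsIntegral E' (ψ v) := i1.map ψ
    have i3 := charpoly_coeff_isIntegral (ψ v) i2 2
    rw [q4_eq] at i3
    obtain ⟨x, hx⟩ := hA (ψ v) (by rw [hψ]; exact (e (φ v)).2)
    rw [hx, isIntegral_algebraMap_iff (algebraMap K M).injective] at i3
    obtain ⟨y, hy⟩ := hcl x i3
    rw [hy, ← IsScalarTower.algebraMap_apply] at hx
    rw [hQ, hx] at hv
    have := LinearMap.congr_fun hl y
    simp only [LinearMap.comp_apply, Algebra.linearMap_apply, LinearMap.id_apply] at this
    rw [this] at hv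
    rw [hx, hv, map_zero]
  have hf : Module.finrank E' (E' ⊗[E] B) = 16 := by rw [Module.finrank_baseChange, hB]
  obtain ⟨W', hW', hWQ⟩ := hq.iso Q 4 (by rw [hf]; norm_num)
  have : Module.Finite E' W' := inferInstance
  let b := Module.finBasisOfFinrankEq E' W' hW'
  let v : Fin 4 → E' ⊗[E] B := fun i => (b i : E' ⊗[E] B)
  have hvW : ∀ i, v i ∈ W' := fun i => (b i).2
  have hv : LinearIndependent E' v := by
    simpa [Function.comp_def] using b.linearIndependent.map' W'.subtype (Submodule.ker_subtype _)
  have hv1 := li_baseChange (φ : E' ⊗[E] B →+ K ⊗[E] B) hφ v hv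
  have hv2 : LinearIndependent K (fun i => e (φ (v i))) := by
    simpa [Function.comp_def] using hv1.map' e.toLinearEquiv.toLinearMap (LinearEquiv.ker _)
  refine ⟨Submodule.span K (Set.range (fun i => e (φ (v i)))), ?_, ?_⟩
  · rw [finrank_span_eq_card hv2]; simp
  · intro X hX
    refine span_iso ((q4m K M).comp A.val.toLinearMap) (fun i => e (φ (v i))) ?_ ?_ X hX
    · intro i
      exact hval _ (hWQ _ (hvW i))
    · intro i j
      have := hval _ (hWQ _ (W'.add_mem (hvW i) (hvW j)))
      rw [hψ, map_add, map_add] at this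
      exact this
end PartG1


noncomputable section

open scoped TensorProduct

/-- `trdeg_F E ≤ n`: there are at most `n` elements of `E` over which `E` is algebraic. -/
def TrdegLE (F E : Type*) [Field F] [Field E] [Algebra F E] (n : ℕ) : Prop :=
  ∃ s : Finset E, s.card ≤ n ∧
    Algebra.IsAlgebraic (IntermediateField.adjoin F (s : Set E)) E

/-- `ed(PGL₄) ≤ m` over `F`: every central simple algebra of degree `4` over every field
extension `K/F` is defined over (i.e. descends to) some intermediate field `E` of
transcendence degree at most `m` over `F`. -/
def csaDegFourEdLE (F : Type u) [Field F] (m : ℕ) : Prop :=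
  ∀ (K : Type u) [Field K] [Algebra F K] (A : Type u) [Ring A] [Algebra K A],
    Module.finrank K A = 16 → Algebra.IsCentral K A → IsSimpleRing A →
    ∃ E : IntermediateField F K, TrdegLE F E m ∧
      ∃ (B : Type u) (_ : Ring B) (_ : Algebra E B),
        Module.finrank E B = 16 ∧ Algebra.IsCentral E B ∧ IsSimpleRing B ∧
        Nonempty ((K ⊗[E] B) ≃ₐ[K] A)

/-- Over a field `F` of characteristic `2`, `ed(PGL₄) ≥ 4`. -/
theorem ed_pgl_four_ge_four (F : Type u) [Field F] [CharP F 2] :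
    ∀ m : ℕ, csaDegFourEdLE F m → 4 ≤ m := by
  intro m hm
  by_contra hlt
  have hm3 : m ≤ 3 := by omega
  let k := AlgebraicClosure F
  have : CharP k 2 := charP_of_injective_algebraMap (algebraMap F k).injective 2
  obtain ⟨K, iK, ik, t, w, c, d, H⟩ := hAn_exists k
  have : CharP K 2 := charP_of_injective_ringHom ik.injective 2
  let : Algebra k K := ik.toAlgebra
  let : Algebra F K := (ik.comp (algebraMap F k)).toAlgebra
  have : IsScalarTower F k K := IsScalarTower.of_algebraMap_eq (fun _ => rfl)
  obtain ⟨M, _, _, A, hM, h16, hc, hs, hq, hW⟩ := main_alg K t w c d H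
  obtain ⟨E, ⟨s, hs3, hsE⟩, B, _, _, hB, -, -, ⟨e⟩⟩ := hm K A h16 hc hs
  classical
  let s' : Finset K := s.image (algebraMap E K)
  let S : IntermediateField k K := IntermediateField.adjoin k (s' : Set K)
  have hS : QP S 8 := ((QP.base k).adjoin s').mono (by
    have h1 : s'.card ≤ 3 := Finset.card_image_le.trans (hs3.trans hm3)
    have h2 : 2 ^ s'.card ≤ 2 ^ 3 := Nat.pow_le_pow_right (by norm_num) h1
    omega)
  let E' : IntermediateField S K := algebraicClosure S K
  have hE' : QP E' 8 := hS.alg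
  have hsS : ∀ y ∈ IntermediateField.adjoin F (s : Set E), algebraMap E K y ∈ S := by
    intro y hy
    induction hy using IntermediateField.adjoin_induction with
    | mem x hx =>
      exact IntermediateField.subset_adjoin _ _ (by simpa [s'] using hx)
    | algebraMap x =>
      rw [← IsScalarTower.algebraMap_apply F E K, IsScalarTower.algebraMap_apply F k K]
      exact S.algebraMap_mem _
    | add x y _ _ h1 h2 => rw [map_add]; exact add_mem h1 h2
    | inv x _ h => rw [map_inv₀]; exact inv_mem h
    | mul x y _ _ h1 h2 => rw [map_mul]; exact mul_mem h1 h2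
  let f : IntermediateField.adjoin F (s : Set E) →+* S :=
    ((algebraMap E K).comp (algebraMap (IntermediateField.adjoin F (s : Set E)) E)).codRestrict S
      (fun y => hsS y.1 y.2)
  have hEE : ∀ y : E, algebraMap E K y ∈ E' := by
    intro y
    rw [mem_algebraicClosure_iff]
    exact (hsE.isAlgebraic y).ringHom_of_comp_eq f (algebraMap E K) f.injective (by ext; rfl)
  let : Algebra E E' := ((algebraMap E K).codRestrict E' hEE).toAlgebra
  have : IsScalarTower E E' K := IsScalarTower.of_algebraMap_eq (fun _ => rfl)
  have : IsScalarTower E' K M := inferInstance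
  obtain ⟨W, hW1, hW2⟩ := glue hB A hq e hE' (by
    intro x hx
    have h1 : IsIntegral S x := isIntegral_trans (A := E') x hx
    exact ⟨⟨x, mem_algebraicClosure_iff.2 h1.isAlgebraic⟩, rfl⟩)
  exact hW W hW1 hW2

end
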